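/- Let $k$ and $\ell$ be multiplicatively independent integers, each at least $2$, and let $d \ge 1$ be an integer. If $X \subseteq \mathbb{N}^d$ is a sparse $k$-automatic set and $Y \subseteq \mathbb{N}^d$ is a sparse $\ell$-automatic set, then the intersection $X \cap Y$ is finite. -/

import Mathlib

/-- Two natural numbers `k, ℓ ≥ 2` are multiplicatively independent if
`k^a = ℓ^b` with integers `a, b` implies `a = b = 0`. -/
def MultIndep (k l : ℕ) : Prop :=
  ∀ a b : ℤ, (k : ℚ) ^ a = (l : ℚ) ^ b → a = 0 ∧ b = 0

/-- The `d`-tuple of natural numbers represented by a word over the alphabet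
`Fin d → Fin k` (each letter is a column of base-`k` digits, most significant
digit first). -/
def decodeTuple (k d : ℕ) (w : List (Fin d → Fin k)) : Fin d → ℕ :=
  fun i => w.foldl (fun a c => k * a + (c i : ℕ)) 0

/-- A word over `Fin d → Fin k` is a canonical base-`k` representation of a
`d`-tuple if its first letter (if any) is not the all-zeros column, i.e.
at least one coordinate word has no leading zero. -/
def CanonicalWord {k d : ℕ} (w : List (Fin d → Fin k)) : Prop :=
  ∀ c ∈ w.head?, ∃ i, (c i : ℕ) ≠ 0

/-- The language of base-`k` expansions (as equal-length padded digit words,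
with minimal padding) of the elements of a set `S ⊆ ℕ^d`. -/
def ReprLang (k d : ℕ) (S : Set (Fin d → ℕ)) : Language (Fin d → Fin k) :=
  { w | CanonicalWord w ∧ decodeTuple k d w ∈ S }

/-- A language over a finite alphabet is sparse if its counting function
`f(n) = #{w ∈ L : |w| ≤ n}` is `O(n^e)` for some natural number `e`. -/
def IsSparseLang {α : Type*} (L : Language α) : Prop :=
  ∃ e C N : ℕ, ∀ n ≥ N, {w ∈ L | w.length ≤ n}.ncard ≤ C * n ^ e

/-- A set `S ⊆ ℕ^d` is a sparse `k`-automatic set if the language of base-`k`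
expansions of its elements is regular and sparse. -/
def IsSparseAutomatic (k d : ℕ) (S : Set (Fin d → ℕ)) : Prop :=
  (ReprLang k d S).IsRegular ∧ IsSparseLang (ReprLang k d S)


theorem sum_weight_ge {ι : Type*} [Fintype ι] {M : ℕ} (hM : Fintype.card ι = M)
    (f : ι → Option (Fin M)) (hf : ∀ i i' n, f i = some n → f i' = some n → i = i') :
    (M : ℝ) * (M - 1) / 2 ≤ ∑ i, ((f i).elim (M : ℝ) fun n => ((n : ℕ) : ℝ)) := by
  classical
  have h1 : ∀ i, (M : ℝ) - ((f i).elim (M : ℝ) fun n => ((n : ℕ) : ℝ)) =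
      ∑ n : Fin M, if f i = some n then ((M : ℝ) - (n : ℕ)) else 0 := by
    intro i
    cases h : f i with
    | none => simp
    | some m => simp
  have h2 : ∑ i, ((M : ℝ) - ((f i).elim (M : ℝ) fun n => ((n : ℕ) : ℝ))) ≤
      ∑ n : Fin M, ((M : ℝ) - (n : ℕ)) := by
    simp_rw [h1]
    rw [Finset.sum_comm]
    refine Finset.sum_le_sum fun n _ => ?_
    have hn : (0 : ℝ) ≤ (M : ℝ) - (n : ℕ) := by
      have : ((n : ℕ) : ℝ) ≤ M := by exact_mod_cast n.2.le
      linarith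
    by_cases hx : ∃ i, f i = some n
    · obtain ⟨i, hi⟩ := hx
      rw [Finset.sum_eq_single i]
      · simp [hi]
      · intro j _ hj
        rw [if_neg]
        intro h
        exact hj (hf _ _ _ h hi)
      · simp
    · push Not at hx
      simp [hx, hn]
  have h3 : ∑ n : Fin M, ((n : ℕ) : ℝ) = (M : ℝ) * (M - 1) / 2 := by
    rw [Fin.sum_univ_eq_sum_range (fun n => (n : ℝ))]
    clear * -
    induction M with
    | zero => simp
    | succ m ih => rw [Finset.sum_range_succ, ih]; push_cast; ring
  simp only [Finset.sum_sub_distrib, Finset.sum_const, Finset.card_univ, hM, Fintype.card_fin,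
    h3] at h2
  linarith

theorem abs_det_le_of_rows {ι : Type*} [Fintype ι] [DecidableEq ι] (A : Matrix ι ι ℝ)
    (b : ι → ℝ) (h : ∀ i a, |A i a| ≤ b i) :
    |A.det| ≤ (Fintype.card ι).factorial * ∏ i, b i := by
  rw [← Matrix.det_transpose, Matrix.det_apply]
  refine (Finset.abs_sum_le_sum_abs _ _).trans ?_
  have : ∀ σ ∈ (Finset.univ : Finset (Equiv.Perm ι)),
      |Equiv.Perm.sign σ • ∏ i, A.transpose (σ i) i| ≤ ∏ i, b i := by
    intro σ _
    have : |Equiv.Perm.sign σ • ∏ i, A.transpose (σ i) i| = ∏ i, |A.transpose (σ i) i| := by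
      rcases Int.units_eq_one_or (Equiv.Perm.sign σ) with h | h <;> simp [h, Finset.abs_prod]
    rw [this]
    exact Finset.prod_le_prod (fun i _ => abs_nonneg _) (fun i _ => h i _)
  refine (Finset.sum_le_sum this).trans ?_
  simp [Fintype.card_perm]

theorem abs_det_le_of_expansion {ι : Type*} [Fintype ι] [DecidableEq ι] (A : Matrix ι ι ℝ)
    {M : ℕ} (hM : Fintype.card ι = M) (c : ι → Fin M → ℝ) (v : Fin M → ι → ℝ)
    (e : ι → ι → ℝ) (hA : ∀ i a, A i a = ∑ n, c i n * v n a + e i a) {B : ℝ} (hB : 0 ≤ B)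
    (hc : ∀ i n a, |c i n * v n a| ≤ B * Real.exp (-(n : ℕ)))
    (he : ∀ i a, |e i a| ≤ B * Real.exp (-M)) :
    |A.det| ≤ ((M : ℝ) + 1) ^ M * (M.factorial * (B ^ M * Real.exp (-(M * (M - 1) / 2)))) := by
  classical
  let g : ι → Option (Fin M) → ι → ℝ := fun i o => o.elim (e i) fun n a => c i n * v n a
  have hAg : A = fun i => ∑ o, g i o := by
    funext i a
    rw [hA, Finset.sum_apply, Fintype.sum_option]
    simp [g, add_comm]
  have hdet : A.det = ∑ f : ι → Option (Fin M), Matrix.det (fun i => g i (f i)) := by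
    conv_lhs => rw [hAg]
    exact (Matrix.detRowAlternating (R := ℝ) (n := ι)).toMultilinearMap.map_sum g
  rw [hdet]
  refine (Finset.abs_sum_le_sum_abs _ _).trans ?_
  have key : ∀ f ∈ (Finset.univ : Finset (ι → Option (Fin M))),
      |Matrix.det (fun i => g i (f i))| ≤
        M.factorial * (B ^ M * Real.exp (-(M * (M - 1) / 2))) := by
    intro f _
    by_cases hf : ∀ i i' n, f i = some n → f i' = some n → i = i'
    · refine (abs_det_le_of_rows (ι := ι) (fun i => g i (f i))
        (fun i => B * Real.exp (-((f i).elim (M : ℝ) fun n => ((n : ℕ) : ℝ)))) ?_).trans ?_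
      · intro i a
        cases h : f i with
        | none => simpa [g] using he i a
        | some n => simpa [g] using hc i n a
      · rw [hM]
        gcongr
        rw [Finset.prod_mul_distrib, Finset.prod_const, Finset.card_univ, hM, ← Real.exp_sum,
          Finset.sum_neg_distrib]
        gcongr
        exact sum_weight_ge hM f hf
    · push Not at hf
      obtain ⟨i, i', n, h1, h2, hne⟩ := hf
      have : Matrix.det (fun i => g i (f i)) = 0 := by
        let d : ι → ℝ := fun j => if j = i then c i n else if j = i' then c i' n else 1
        let G : Matrix ι ι ℝ := fun j => if j = i then v n else if j = i' then v n else g j (f j)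
        have hG : (fun i => g i (f i)) = Matrix.of fun j a => d j * G j a := by
          funext j a
          by_cases hj : j = i
          · subst hj; simp [d, G, g, h1]
          · by_cases hj' : j = i'
            · subst hj'; simp [d, G, g, h2, hj]
            · simp [d, G, hj, hj']
        rw [hG, Matrix.det_mul_column, Matrix.det_zero_of_row_eq hne, mul_zero]
        simp [G]
      rw [this, abs_zero]
      positivity
  refine (Finset.sum_le_sum key).trans ?_
  simp [Fintype.card_pi, hM]
open Polynomial in
theorem shifted_det_ne_zero {m : ℕ} (y : Fin m → ℝ) (hy : Function.Injective y)
    (P : Fin m → ℝ[X]) (hP : ∀ b, P b ≠ 0) :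
    (Matrix.of fun a b : Fin m =>
      C (y b ^ (a : ℕ)) * (P b).comp (X + C ((a : ℕ) : ℝ))).det ≠ 0 := by
  classical
  intro h0
  set n := ∑ b, (P b).natDegree with hn
  have hle : ∀ b, (P b).natDegree ≤ n := fun b =>
    Finset.single_le_sum (f := fun b => (P b).natDegree) (fun _ _ => Nat.zero_le _)
      (Finset.mem_univ b)
  have h1 : (Matrix.of fun a b : Fin m => (X : ℝ[X]) ^ (n - (P b).natDegree) *
      (C (y b ^ (a : ℕ)) * (P b).comp (X + C ((a : ℕ) : ℝ)))).det = 0 := by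
    have := Matrix.det_mul_row (fun b => (X : ℝ[X]) ^ (n - (P b).natDegree))
      (Matrix.of fun a b : Fin m => C (y b ^ (a : ℕ)) * (P b).comp (X + C ((a : ℕ) : ℝ)))
    rw [h0, mul_zero] at this
    exact this
  have hdeg : ∀ a b : Fin m, ((X : ℝ[X]) ^ (n - (P b).natDegree) *
      (C (y b ^ (a : ℕ)) * (P b).comp (X + C ((a : ℕ) : ℝ)))).natDegree ≤ n := by
    intro a b
    refine natDegree_mul_le.trans ?_
    have h2 : (C (y b ^ (a : ℕ)) * (P b).comp (X + C ((a : ℕ) : ℝ))).natDegree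
        ≤ (P b).natDegree := by
      refine (natDegree_C_mul_le _ _).trans ?_
      rw [natDegree_comp, natDegree_X_add_C, mul_one]
    rw [natDegree_X_pow]
    have := hle b
    omega
  have hcoeff : ∀ a b : Fin m, ((X : ℝ[X]) ^ (n - (P b).natDegree) *
      (C (y b ^ (a : ℕ)) * (P b).comp (X + C ((a : ℕ) : ℝ)))).coeff n =
      (P b).leadingCoeff * y b ^ (a : ℕ) := by
    intro a b
    have h3 : ((P b).comp (X + C ((a : ℕ) : ℝ))).coeff (P b).natDegree = (P b).leadingCoeff := by
      have h4 : ((P b).comp (X + C ((a : ℕ) : ℝ))).natDegree = (P b).natDegree := by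
        rw [natDegree_comp, natDegree_X_add_C, mul_one]
      rw [← h4, coeff_natDegree, leadingCoeff_comp (by rw [natDegree_X_add_C]; exact one_ne_zero),
        leadingCoeff_X_add_C, one_pow, mul_one]
    rw [coeff_X_pow_mul', if_pos (Nat.sub_le _ _), Nat.sub_sub_self (hle b), coeff_C_mul, h3,
      mul_comm]
  have h5 : (Matrix.of fun a b : Fin m => (P b).leadingCoeff * y b ^ (a : ℕ)).det = 0 := by
    have h6 := congrArg (fun q : ℝ[X] => q.coeff (m * n)) h1
    simp only [coeff_zero] at h6
    rw [← h6, Matrix.det_apply, Matrix.det_apply, finsetSum_coeff]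
    refine Finset.sum_congr rfl fun σ _ => ?_
    rw [coeff_smul]
    congr 1
    have := coeff_prod_of_natDegree_le (s := Finset.univ) (fun b : Fin m =>
      (X : ℝ[X]) ^ (n - (P b).natDegree) *
      (C (y b ^ (σ b : ℕ)) * (P b).comp (X + C ((σ b : ℕ) : ℝ)))) n (fun b _ => hdeg _ _)
    rw [Finset.card_univ, Fintype.card_fin] at this
    simp only [Matrix.of_apply]
    rw [this]
    exact Finset.prod_congr rfl fun b _ => (hcoeff _ _).symm
  have h7 := Matrix.det_mul_row (fun b => (P b).leadingCoeff)
    (Matrix.of fun a b : Fin m => y b ^ (a : ℕ))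
  simp only [Matrix.of_apply] at h7
  rw [h5] at h7
  have h8 : (Matrix.of fun a b : Fin m => y b ^ (a : ℕ)).det ≠ 0 := by
    rw [← Matrix.det_transpose]
    exact Matrix.det_vandermonde_ne_zero_iff.mpr hy
  have h9 : ∏ b, (P b).leadingCoeff ≠ 0 :=
    Finset.prod_ne_zero_iff.mpr fun b _ => leadingCoeff_ne_zero.mpr (hP b)
  exact mul_ne_zero h9 h8 h7.symm

open Polynomial in
theorem eq_zero_of_vanishing_on_grid {K L N R S : ℕ} (hK : 0 < K) {α w : ℝ} (hα : 0 < α)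
    (hα1 : α ≠ 1) (hw : 0 < w) (hRN : R ≤ N) (hKL : K * L ≤ S * R) (P : Fin L → ℝ[X])
    (hdeg : ∀ j, (P j).natDegree < K)
    (h : ∀ r < R + L, ∀ s < S,
      ∑ j, (P j).eval ((r : ℝ) + N * s) * (α ^ ((j : ℕ) * r) * w ^ ((j : ℕ) * s)) = 0) :
    ∀ j, P j = 0 := by
  classical
  by_contra hne
  push Not at hne
  obtain ⟨j₀, hj₀⟩ := hne
  let J : Finset (Fin L) := Finset.univ.filter fun j => P j ≠ 0
  obtain ⟨m, hm⟩ : ∃ m, J.card = m := ⟨_, rfl⟩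
  let e : Fin m ≃ J := (Finset.equivFinOfCardEq hm).symm
  have hJ : ∀ b, P (e b) ≠ 0 := fun b => (Finset.mem_filter.mp (e b).2).2
  have hmpos : 0 < m := by
    rw [← hm]; exact Finset.card_pos.mpr ⟨j₀, by simp [J, hj₀]⟩
  have hmL : m ≤ L := by
    rw [← hm]; exact (Finset.card_le_univ _).trans (by simp)
  set D := (Matrix.of fun a b : Fin m =>
      C ((α ^ ((e b : Fin L) : ℕ)) ^ (a : ℕ)) * (P (e b)).comp (X + C ((a : ℕ) : ℝ))).det with hD
  have hDne : D ≠ 0 := by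
    refine shifted_det_ne_zero (fun b => α ^ ((e b : Fin L) : ℕ)) ?_ (fun b => P (e b)) hJ
    intro b b' hbb
    have := pow_right_injective₀ hα hα1 hbb
    exact e.injective (Subtype.ext (Fin.ext this))
  have hDdeg : D.natDegree ≤ m * (K - 1) := by
    rw [hD, Matrix.det_apply]
    refine natDegree_sum_le_of_forall_le _ _ fun σ _ => ?_
    refine (natDegree_smul_le _ _).trans ?_
    refine (natDegree_prod_le _ _).trans ?_
    refine (Finset.sum_le_card_nsmul _ _ (K - 1) fun b _ => ?_).trans (by simp)
    simp only [Matrix.of_apply]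
    refine (natDegree_C_mul_le _ _).trans ?_
    rw [natDegree_comp, natDegree_X_add_C, mul_one]
    have := hdeg (e b)
    omega
  have hDzero : ∀ r < R, ∀ s < S, D.eval ((r : ℝ) + N * s) = 0 := by
    intro r hr s hs
    rw [← coe_evalRingHom, hD, RingHom.map_det]
    refine Matrix.exists_mulVec_eq_zero_iff.mp
      ⟨fun b => α ^ (((e b : Fin L) : ℕ) * r) * w ^ (((e b : Fin L) : ℕ) * s), ?_, ?_⟩
    · intro hz
      have := congrFun hz ⟨0, hmpos⟩
      simp only [Pi.zero_apply] at this
      exact (ne_of_gt (by positivity)) this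
    · funext a
      have ha : r + (a : ℕ) < R + L := by have := a.2; omega
      have h1 := h _ ha s hs
      rw [← Finset.sum_filter_add_sum_filter_not _ (fun j => P j ≠ 0)] at h1
      have h2 : ∑ j with ¬ P j ≠ 0, (P j).eval (((r + (a : ℕ) : ℕ) : ℝ) + N * s) *
          (α ^ ((j : ℕ) * (r + (a : ℕ))) * w ^ ((j : ℕ) * s)) = 0 := by
        refine Finset.sum_eq_zero fun j hj => ?_
        have : P j = 0 := by simpa using hj
        simp [this]
      rw [h2, add_zero] at h1
      have h3 := Finset.sum_coe_sort J fun j => (P j).eval (((r + (a : ℕ) : ℕ) : ℝ) + N * s) *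
          (α ^ ((j : ℕ) * (r + (a : ℕ))) * w ^ ((j : ℕ) * s))
      rw [Pi.zero_apply, ← h1, ← h3, ← e.sum_comp]
      rw [Matrix.mulVec, dotProduct]
      refine Finset.sum_congr rfl fun b _ => ?_
      simp only [RingHom.mapMatrix_apply, Matrix.map_apply, Matrix.of_apply, coe_evalRingHom,
        eval_mul, eval_C, eval_comp, eval_add, eval_X]
      have : ((r : ℝ) + N * s + (a : ℕ)) = ((r + (a : ℕ) : ℕ) : ℝ) + N * s := by push_cast; ring
      rw [this, ← pow_mul, mul_add, pow_add]
      ring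
  let pt : Fin R × Fin S → ℝ := fun x => ((x.1 : ℕ) : ℝ) + N * ((x.2 : ℕ) : ℝ)
  have hpt : Function.Injective pt := by
    rintro ⟨⟨r, hr⟩, ⟨s, hs⟩⟩ ⟨⟨r', hr'⟩, ⟨s', hs'⟩⟩ hx
    simp only [pt] at hx
    have hx' : r + N * s = r' + N * s' := by exact_mod_cast hx
    have hr1 : r = r' := by
      have := congrArg (· % N) hx'
      simpa [Nat.add_mul_mod_self_left, Nat.mod_eq_of_lt (hr.trans_le hRN),
        Nat.mod_eq_of_lt (hr'.trans_le hRN)] using this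
    subst hr1
    have hN : 0 < N := by omega
    have : s = s' := Nat.eq_of_mul_eq_mul_left hN (by omega)
    subst this
    rfl
  refine hDne (eq_zero_of_natDegree_lt_card_of_eval_eq_zero D hpt ?_ ?_)
  · rintro ⟨r, s⟩
    exact hDzero r r.2 s s.2
  · rw [Fintype.card_prod, Fintype.card_fin, Fintype.card_fin]
    calc D.natDegree ≤ m * (K - 1) := hDdeg
      _ < m * K := Nat.mul_lt_mul_of_pos_left (by omega) hmpos
      _ ≤ L * K := Nat.mul_le_mul_right _ hmL
      _ = K * L := mul_comm _ _
      _ ≤ S * R := hKL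
      _ = R * S := mul_comm _ _
theorem exists_det_submatrix_ne_zero {ι κ : Type*} [Fintype ι] [DecidableEq ι] [Fintype κ]
    (V : Matrix ι κ ℝ) (hV : LinearIndependent ℝ V.row) :
    ∃ g : ι → κ, (V.submatrix id g).det ≠ 0 := by
  classical
  obtain ⟨κ', a, ha, hspan, hind⟩ := exists_linearIndependent' ℝ V.col
  have : Fintype κ' := Fintype.ofInjective a ha
  have hcard : Fintype.card κ' = Fintype.card ι := by
    rw [← finrank_span_eq_card hind, hspan, ← Matrix.rank_eq_finrank_span_cols, hV.rank_matrix]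
  let e : ι ≃ κ' := (Fintype.equivOfCardEq hcard).symm
  refine ⟨a ∘ e, ?_⟩
  have h2 : LinearIndependent ℝ (V.submatrix id (a ∘ e)).col := hind.comp e e.injective
  exact ((Matrix.isUnit_iff_isUnit_det _).mp
    (Matrix.linearIndependent_cols_iff_isUnit.mp h2)).ne_zero

open Polynomial in
theorem linearIndependent_binomial_exponentials {K L N R S : ℕ} (hK : 0 < K) {α w : ℝ}
    (hα : 0 < α) (hα1 : α ≠ 1) (hw : 0 < w) (hRN : R ≤ N) (hKL : K * L ≤ S * R) :
    LinearIndependent ℝ (Matrix.of fun (x : Fin K × Fin L) (y : Fin (R + L) × Fin S) =>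
      (((y.1 : ℕ) + N * (y.2 : ℕ)).choose x.1 : ℝ) *
        (α ^ ((x.2 : ℕ) * y.1) * w ^ ((x.2 : ℕ) * y.2))).row := by
  rw [Fintype.linearIndependent_iff]
  intro c hc
  let P : Fin L → ℝ[X] := fun j =>
    ∑ i : Fin K, C (c (i, j) / ((i : ℕ).factorial : ℝ)) * descPochhammer ℝ i
  have hP : ∀ j, ∀ z : ℕ, (P j).eval (z : ℝ) = ∑ i : Fin K, c (i, j) * (z.choose i : ℝ) := by
    intro j z
    simp only [P, eval_finsetSum, eval_mul, eval_C]
    refine Finset.sum_congr rfl fun i _ => ?_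
    rw [descPochhammer_eval_eq_descFactorial, Nat.descFactorial_eq_factorial_mul_choose]
    have : ((i : ℕ).factorial : ℝ) ≠ 0 := by exact_mod_cast Nat.factorial_ne_zero _
    push_cast
    field_simp
  have hPdeg : ∀ j, (P j).natDegree < K := by
    intro j
    refine Nat.lt_of_le_pred hK (natDegree_sum_le_of_forall_le _ _ fun i _ => ?_)
    refine (natDegree_C_mul_le _ _).trans ?_
    rw [descPochhammer_natDegree]
    exact Nat.le_pred_of_lt i.2
  have hP0 := eq_zero_of_vanishing_on_grid hK hα hα1 hw hRN hKL P hPdeg (by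
    intro r hr s hs
    have h1 := congrFun hc (⟨r, hr⟩, ⟨s, hs⟩)
    simp only [Finset.sum_apply, Pi.smul_apply, smul_eq_mul, Matrix.row_apply, Matrix.of_apply,
      Pi.zero_apply] at h1
    rw [← h1, Fintype.sum_prod_type_right]
    refine Finset.sum_congr rfl fun j _ => ?_
    have : (r : ℝ) + N * s = ((r + N * s : ℕ) : ℝ) := by push_cast; ring
    rw [this, hP, Finset.sum_mul]
    refine Finset.sum_congr rfl fun i _ => ?_
    ring)
  rintro ⟨⟨i, hi⟩, j⟩
  induction i using Nat.strong_induction_on with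
  | _ i ih =>
    have h1 := hP j i
    rw [hP0 j, eval_zero, Finset.sum_eq_single (⟨i, hi⟩ : Fin K)] at h1
    · simpa using h1.symm
    · rintro ⟨i', hi'⟩ _ hne
      rcases lt_trichotomy i' i with h | h | h
      · rw [ih i' h hi', zero_mul]
      · exact absurd (Fin.ext h) hne
      · simp [Nat.choose_eq_zero_of_lt h]
    · simp

theorem one_le_pow_mul_abs_det {ι : Type*} [Fintype ι] [DecidableEq ι] (A : Matrix ι ι ℝ)
    (hA : A.det ≠ 0) (D : ℝ) (hD : 0 < D) (z : ι → ι → ℤ) (hz : ∀ i a, D * A i a = z i a) :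
    1 ≤ D ^ Fintype.card ι * |A.det| := by
  have h1 : D ^ Fintype.card ι * A.det = ((Matrix.det (Matrix.of z) : ℤ) : ℝ) := by
    rw [← Matrix.det_smul, ← eq_intCast (Int.castRingHom ℝ), RingHom.map_det]
    congr 1
    ext i a
    simpa using hz i a
  have h2 : Matrix.det (Matrix.of z) ≠ 0 := by
    intro h
    rw [h, Int.cast_zero] at h1
    exact mul_ne_zero (pow_pos hD _).ne' hA h1
  rw [← abs_of_pos (pow_pos hD (Fintype.card ι)), ← abs_mul, h1]
  exact_mod_cast Int.one_le_abs h2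

theorem choose_mul_pow_eq_sum (x : ℝ) {z i T : ℕ} (hT : z < T) :
    (z.choose i : ℝ) * x ^ z =
      ∑ n ∈ Finset.range T, (x ^ i * (n.choose i * (x - 1) ^ (n - i))) * (z.choose n : ℝ) := by
  rcases lt_or_ge z i with h | h
  · rw [Nat.choose_eq_zero_of_lt h, Nat.cast_zero, zero_mul]
    symm
    refine Finset.sum_eq_zero fun n _ => ?_
    rcases lt_or_ge n i with h' | h'
    · simp [Nat.choose_eq_zero_of_lt h']
    · simp [Nat.choose_eq_zero_of_lt (h.trans_le h')]
  · have h1 : x ^ (z - i) = ∑ m ∈ Finset.range (z - i + 1), (x - 1) ^ m * ((z - i).choose m : ℝ) := by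
      have := add_pow (x - 1) 1 (z - i)
      simpa using this
    have h2 : ∑ n ∈ Finset.range T,
        (x ^ i * (n.choose i * (x - 1) ^ (n - i))) * (z.choose n : ℝ) =
        ∑ n ∈ Finset.Ico i (z + 1),
        (x ^ i * (n.choose i * (x - 1) ^ (n - i))) * (z.choose n : ℝ) := by
      symm
      refine Finset.sum_subset ?_ ?_
      · intro n hn
        simp only [Finset.mem_Ico, Finset.mem_range] at *
        omega
      · intro n _ hn
        simp only [Finset.mem_Ico, not_and_or, not_le, not_lt] at hn
        rcases hn with hn | hn
        · simp [Nat.choose_eq_zero_of_lt hn]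
        · simp [Nat.choose_eq_zero_of_lt (Nat.lt_of_succ_le hn)]
    rw [h2, Finset.sum_Ico_eq_sum_range, Nat.succ_sub h, ← Nat.add_sub_of_le h, pow_add,
      Nat.add_sub_of_le h, h1, Finset.mul_sum, Finset.mul_sum]
    refine Finset.sum_congr rfl fun m hm => ?_
    have hm' : i + m ≤ z := by
      have := Finset.mem_range.mp hm
      omega
    have h3 : z.choose (i + m) * (i + m).choose i = z.choose i * (z - i).choose m := by
      rw [Nat.choose_mul (Nat.le_add_right i m), Nat.add_sub_cancel_left]
    have h4 : (z.choose (i + m) : ℝ) * ((i + m).choose i : ℝ) =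
        z.choose i * ((z - i).choose m : ℝ) := by exact_mod_cast h3
    rw [Nat.add_sub_cancel_left]
    linear_combination -(x ^ i * (x - 1) ^ m) * h4

theorem choose_mul_pow_le_exp {t : ℝ} (ht : 0 ≤ t) (z n : ℕ) :
    (z.choose n : ℝ) * t ^ n ≤ Real.exp (t * z) := by
  rcases lt_or_ge z n with h | h
  · simp [Nat.choose_eq_zero_of_lt h, Real.exp_nonneg]
  · have h1 : (t + 1) ^ z = ∑ m ∈ Finset.range (z + 1), t ^ m * (z.choose m : ℝ) := by
      simpa using add_pow t 1 z
    have h2 : t ^ n * (z.choose n : ℝ) ≤ (t + 1) ^ z := by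
      rw [h1]
      exact Finset.single_le_sum (f := fun m => t ^ m * (z.choose m : ℝ))
        (fun m _ => by positivity) (Finset.mem_range.mpr (Nat.lt_succ_of_le h))
    calc (z.choose n : ℝ) * t ^ n = t ^ n * (z.choose n : ℝ) := mul_comm _ _
      _ ≤ (t + 1) ^ z := h2
      _ ≤ (Real.exp t) ^ z := by gcongr; exact Real.add_one_le_exp t
      _ = Real.exp (t * z) := by rw [← Real.exp_nat_mul, mul_comm]

theorem abs_newton_term_le {x b E : ℝ} (hb0 : 0 < b) (hb1 : b ≤ 1) (hx1 : |x - 1| ≤ b)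
    {i K z Z : ℕ} (hx : |x ^ i| ≤ E) (hi : i ≤ K) (hz : z ≤ Z) (n : ℕ) :
    |(x ^ i * (n.choose i * (x - 1) ^ (n - i))) * (z.choose n : ℝ)| ≤
      E * (b ^ K)⁻¹ * Real.exp (6 * b * Z) * Real.exp (-(n : ℝ)) := by
  have hE : 0 ≤ E := (abs_nonneg _).trans hx
  rcases lt_or_ge n i with h | h
  · simp only [Nat.choose_eq_zero_of_lt h, Nat.cast_zero, zero_mul, mul_zero, abs_zero]
    positivity
  · have h1 : (z.choose n : ℝ) * (6 * b) ^ n ≤ Real.exp (6 * b * Z) :=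
      (choose_mul_pow_le_exp (by positivity) z n).trans (by gcongr)
    have h2 : (n.choose i : ℝ) ≤ 2 ^ n := by exact_mod_cast Nat.choose_le_two_pow n i
    have h3 : b ^ n * (b ^ K)⁻¹ ≥ b ^ (n - i) := by
      have : b ^ K ≤ b ^ i := pow_le_pow_of_le_one hb0.le hb1 hi
      rw [ge_iff_le, le_mul_inv_iff₀ (by positivity)]
      calc b ^ (n - i) * b ^ K ≤ b ^ (n - i) * b ^ i := by gcongr
        _ = b ^ n := by rw [← pow_add, Nat.sub_add_cancel h]
    have h4 : Real.exp (n : ℝ) ≤ 3 ^ n := by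
      rw [← mul_one (n : ℝ), Real.exp_nat_mul]
      gcongr
      exact (Real.exp_one_lt_d9.trans (by norm_num)).le
    have h5 : (2 : ℝ) ^ n * b ^ n ≤ (6 * b) ^ n * Real.exp (-(n : ℝ)) := by
      rw [Real.exp_neg, le_mul_inv_iff₀ (Real.exp_pos _)]
      calc (2 : ℝ) ^ n * b ^ n * Real.exp n ≤ 2 ^ n * b ^ n * 3 ^ n := by gcongr
        _ = (6 * b) ^ n := by rw [← mul_pow, ← mul_pow]; ring_nf
    rw [abs_mul, abs_mul, abs_mul, abs_pow (x - 1), Nat.abs_cast, Nat.abs_cast]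
    calc |x ^ i| * ((n.choose i : ℝ) * |x - 1| ^ (n - i)) * (z.choose n : ℝ)
        ≤ E * (2 ^ n * b ^ (n - i)) * (z.choose n : ℝ) := by gcongr
      _ ≤ E * (2 ^ n * (b ^ n * (b ^ K)⁻¹)) * (z.choose n : ℝ) := by gcongr
      _ = E * (b ^ K)⁻¹ * (z.choose n : ℝ) * (2 ^ n * b ^ n) := by ring
      _ ≤ E * (b ^ K)⁻¹ * (z.choose n : ℝ) * ((6 * b) ^ n * Real.exp (-(n : ℝ))) := by gcongr
      _ = E * (b ^ K)⁻¹ * ((z.choose n : ℝ) * (6 * b) ^ n) * Real.exp (-(n : ℝ)) := by ring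
      _ ≤ _ := by gcongr

theorem exp_pow_bounds {a b : ℝ} (hb0 : 0 < b) (hb1 : b ≤ 1) {j L : ℕ} (hj : j ≤ L)
    (ha : L * |a| ≤ b / 2) :
    |Real.exp a ^ j - 1| ≤ b ∧
      ∀ m Z : ℕ, m ≤ Z → |(Real.exp a ^ j) ^ m| ≤ Real.exp (b / 2 * Z) := by
  have hxe : Real.exp a ^ j = Real.exp (j * a) := by rw [← Real.exp_nat_mul]
  have hja : |j * a| ≤ b / 2 := by
    rw [abs_mul, Nat.abs_cast]
    exact le_trans (by gcongr) ha
  rw [hxe]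
  refine ⟨(Real.abs_exp_sub_one_le (by linarith)).trans (by linarith), fun m Z hm => ?_⟩
  rw [← Real.exp_nat_mul, abs_of_pos (Real.exp_pos _), Real.exp_le_exp]
  calc (m : ℝ) * (j * a) ≤ m * (b / 2) := by gcongr; exact (le_abs_self _).trans hja
    _ ≤ Z * (b / 2) := by gcongr
    _ = _ := mul_comm _ _

theorem abs_perturbed_sub_newton_le {a ω b : ℝ} (hb0 : 0 < b) (hb1 : b ≤ 1)
    {i j r s K L N S Z M : ℕ} (hi : i ≤ K) (hj : j ≤ L) (hs : s ≤ S) (hz : r + N * s ≤ Z)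
    (hKZ : K ≤ Z) (ha : L * |a| ≤ b / 2)
    (hΛ : 2 * L * S * |N * a - ω| ≤ Real.exp (-M)) :
    |((r + N * s).choose i : ℝ) * (Real.exp a ^ (j * r) * Real.exp ω ^ (j * s)) -
      ∑ n ∈ Finset.range M, ((Real.exp a ^ j) ^ i * (n.choose i * (Real.exp a ^ j - 1) ^ (n - i)))
        * ((r + N * s).choose n : ℝ)| ≤
      ((Z : ℝ) + 2) * (Real.exp (b / 2 * Z) * (b ^ K)⁻¹ * Real.exp (6 * b * Z)) *
        Real.exp (-M) := by
  set z := r + N * s with hzdef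
  set x := Real.exp a ^ j with hx
  have hxe : x = Real.exp (j * a) := by rw [hx, ← Real.exp_nat_mul]
  obtain ⟨hx1, hxpow'⟩ := exp_pow_bounds hb0 hb1 hj ha
  have hxpow : ∀ m : ℕ, m ≤ Z → |x ^ m| ≤ Real.exp (b / 2 * Z) := fun m hm => hxpow' m Z hm
  set E := Real.exp (b / 2 * Z) with hE
  have hmain := choose_mul_pow_eq_sum x (z := z) (i := i) (T := M + (Z + 1)) (by omega)
  rw [Finset.sum_range_add] at hmain
  set f : ℕ → ℝ := fun n => (x ^ i * (n.choose i * (x - 1) ^ (n - i))) * (z.choose n : ℝ) with hf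
  have htail : |∑ k ∈ Finset.range (Z + 1), f (M + k)| ≤
      (Z + 1) * (E * (b ^ K)⁻¹ * Real.exp (6 * b * Z)) * Real.exp (-M) := by
    refine (Finset.abs_sum_le_sum_abs _ _).trans ?_
    refine (Finset.sum_le_card_nsmul _ _ (E * (b ^ K)⁻¹ * Real.exp (6 * b * Z) * Real.exp (-M))
      fun k _ => ?_).trans ?_
    · refine (abs_newton_term_le hb0 hb1 hx1 (hxpow i (hi.trans hKZ)) hi hz (M + k)).trans ?_
      gcongr
      omega
    · rw [Finset.card_range, nsmul_eq_mul]
      push_cast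
      exact le_of_eq (by ring)
  have hpert : |(z.choose i : ℝ) * (Real.exp a ^ (j * r) * Real.exp ω ^ (j * s)) -
      (z.choose i : ℝ) * x ^ z| ≤ (E * (b ^ K)⁻¹ * Real.exp (6 * b * Z)) * Real.exp (-M) := by
    have h1 : Real.exp a ^ (j * r) * Real.exp ω ^ (j * s) =
        x ^ z * Real.exp (j * s * (ω - N * a)) := by
      rw [hxe, ← Real.exp_nat_mul, ← Real.exp_nat_mul, ← Real.exp_nat_mul, ← Real.exp_add,
        ← Real.exp_add, hzdef]
      push_cast
      ring_nf
    have h2 : 2 * |(j : ℝ) * s * (ω - N * a)| ≤ Real.exp (-M) := by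
      rw [abs_mul, abs_mul, Nat.abs_cast, Nat.abs_cast, abs_sub_comm]
      refine le_trans ?_ hΛ
      calc 2 * ((j : ℝ) * s * |N * a - ω|) ≤ 2 * ((L : ℝ) * S * |N * a - ω|) := by gcongr
        _ = _ := by ring
    have h3 : |Real.exp (j * s * (ω - N * a)) - 1| ≤ Real.exp (-M) := by
      refine (Real.abs_exp_sub_one_le ?_).trans h2
      have : Real.exp (-(M : ℝ)) ≤ 1 := Real.exp_le_one_iff.mpr (by simp)
      linarith
    have h4 : (z.choose i : ℝ) ≤ (b ^ K)⁻¹ * Real.exp (6 * b * Z) := by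
      have h5 := choose_mul_pow_le_exp hb0.le z i
      have h6 : b ^ K ≤ b ^ i := pow_le_pow_of_le_one hb0.le hb1 hi
      rw [mul_comm, ← div_eq_mul_inv, le_div_iff₀ (by positivity)]
      calc (z.choose i : ℝ) * b ^ K ≤ z.choose i * b ^ i := by gcongr
        _ ≤ Real.exp (b * z) := h5
        _ ≤ Real.exp (6 * b * Z) := by
          have : (z : ℝ) ≤ Z := by exact_mod_cast hz
          gcongr
          linarith
    rw [h1, ← mul_sub, abs_mul, Nat.abs_cast, ← mul_sub_one, abs_mul]
    calc (z.choose i : ℝ) * (|x ^ z| * |Real.exp (j * s * (ω - N * a)) - 1|)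
        ≤ ((b ^ K)⁻¹ * Real.exp (6 * b * Z)) * (E * Real.exp (-M)) := by
          gcongr
          exact hxpow z hz
      _ = _ := by ring
  have hsplit : (z.choose i : ℝ) * (Real.exp a ^ (j * r) * Real.exp ω ^ (j * s)) -
      ∑ n ∈ Finset.range M, f n = ((z.choose i : ℝ) * (Real.exp a ^ (j * r) *
        Real.exp ω ^ (j * s)) - (z.choose i : ℝ) * x ^ z) +
        ∑ k ∈ Finset.range (Z + 1), f (M + k) := by
    rw [hmain]; ring
  change |_ - ∑ n ∈ Finset.range M, f n| ≤ _
  rw [hsplit]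
  refine (abs_add_le _ _).trans ((add_le_add hpert htail).trans (le_of_eq ?_))
  ring

theorem no_small_linear_form {p q u v N K L R S : ℕ} (hp : 0 < p) (hq : 0 < q) (hu : 0 < u)
    (hv : 0 < v) (hpq : p ≠ q) (hK : 0 < K) (hL : 0 < L) (hRN : R ≤ N)
    (hKL : K * L ≤ S * R) {b : ℝ} (hb0 : 0 < b) (hb1 : b ≤ 1)
    (hαb : L * |Real.log p - Real.log q| ≤ b / 2)
    (hΛ : 2 * L * S * |N * (Real.log p - Real.log q) - (Real.log u - Real.log v)| ≤
      Real.exp (-(K * L : ℕ)))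
    (hfin : L * (R + L : ℕ) * Real.log q + L * S * Real.log v +
      Real.log (((K * L : ℕ) + 1) * (K * L : ℕ) * ((R + L + N * S : ℕ) + 2)) +
      8 * b * (R + L + N * S : ℕ) + K * Real.log (1 / b) < ((K * L : ℕ) - 1) / 2) : False := by
  classical
  set M := K * L with hM
  set Z := R + L + N * S with hZ
  set a := Real.log p - Real.log q with ha
  set ω := Real.log u - Real.log v with hω
  have hp' : (0 : ℝ) < p := by exact_mod_cast hp
  have hq' : (0 : ℝ) < q := by exact_mod_cast hq
  have hu' : (0 : ℝ) < u := by exact_mod_cast hu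
  have hv' : (0 : ℝ) < v := by exact_mod_cast hv
  have hα : Real.exp a = p / q := by rw [ha, Real.exp_sub, Real.exp_log hp', Real.exp_log hq']
  have hw : Real.exp ω = u / v := by rw [hω, Real.exp_sub, Real.exp_log hu', Real.exp_log hv']
  have hα1 : Real.exp a ≠ 1 := by
    rw [hα, Ne, div_eq_one_iff_eq hq'.ne']
    exact_mod_cast hpq
  have hMpos : 0 < M := Nat.mul_pos hK hL
  have hKZ : K ≤ Z := by
    calc K ≤ K * L := Nat.le_mul_of_pos_right K hL
      _ ≤ S * R := hKL
      _ ≤ S * N := Nat.mul_le_mul_left _ hRN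
      _ ≤ Z := by rw [hZ, mul_comm]; exact Nat.le_add_left _ _
  obtain ⟨g, hg⟩ := exists_det_submatrix_ne_zero _ (linearIndependent_binomial_exponentials
    (N := N) hK (Real.exp_pos a) hα1 (Real.exp_pos ω) hRN hKL)
  set A := (Matrix.of fun (x : Fin K × Fin L) (y : Fin (R + L) × Fin S) =>
      (((y.1 : ℕ) + N * (y.2 : ℕ)).choose x.1 : ℝ) *
        (Real.exp a ^ ((x.2 : ℕ) * y.1) * Real.exp ω ^ ((x.2 : ℕ) * y.2))).submatrix id g with hA
  have hcard : Fintype.card (Fin K × Fin L) = M := by simp [hM]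
  set D : ℝ := (q : ℝ) ^ (L * (R + L)) * (v : ℝ) ^ (L * S) with hD
  have hDpos : 0 < D := by positivity
  have hlow := one_le_pow_mul_abs_det A hg D hDpos
    (fun x y => (((((g y).1 : ℕ) + N * ((g y).2 : ℕ)).choose x.1 *
      (p ^ ((x.2 : ℕ) * (g y).1) * q ^ (L * (R + L) - (x.2 : ℕ) * (g y).1) *
      (u ^ ((x.2 : ℕ) * (g y).2) * v ^ (L * S - (x.2 : ℕ) * (g y).2))) : ℕ) : ℤ)) (by
    rintro ⟨i, j⟩ y
    generalize hgy : g y = rs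
    obtain ⟨r, s⟩ := rs
    have h1 : (j : ℕ) * r ≤ L * (R + L) := Nat.mul_le_mul j.2.le r.2.le
    have h2 : (j : ℕ) * s ≤ L * S := Nat.mul_le_mul j.2.le s.2.le
    simp only [hA, Matrix.submatrix_apply, id, Matrix.of_apply, hgy]
    rw [hα, hw, hD]
    push_cast
    have e1 : (q : ℝ) ^ (L * (R + L)) = q ^ (L * (R + L) - j * r) * q ^ ((j : ℕ) * r) := by
      rw [← pow_add, Nat.sub_add_cancel h1]
    have e2 : (v : ℝ) ^ (L * S) = v ^ (L * S - j * s) * v ^ ((j : ℕ) * s) := by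
      rw [← pow_add, Nat.sub_add_cancel h2]
    rw [e1, e2, div_pow, div_pow]
    field_simp)
  set B : ℝ := ((Z : ℝ) + 2) * (Real.exp (b / 2 * Z) * (b ^ K)⁻¹ * Real.exp (6 * b * Z)) with hB
  have hBpos : 0 < B := by positivity
  have hup := abs_det_le_of_expansion A hcard
    (fun x n => (Real.exp a ^ (x.2 : ℕ)) ^ (x.1 : ℕ) *
      ((n : ℕ).choose x.1 * (Real.exp a ^ (x.2 : ℕ) - 1) ^ ((n : ℕ) - x.1)))
    (fun n y => ((((g y).1 : ℕ) + N * ((g y).2 : ℕ)).choose n : ℝ))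
    (fun x y => A x y - ∑ n ∈ Finset.range M, ((Real.exp a ^ (x.2 : ℕ)) ^ (x.1 : ℕ) *
      (n.choose x.1 * (Real.exp a ^ (x.2 : ℕ) - 1) ^ (n - x.1))) *
      ((((g y).1 : ℕ) + N * ((g y).2 : ℕ)).choose n : ℝ))
    (by
      intro x y
      rw [Finset.sum_range]
      ring) hBpos.le
    (by
      rintro ⟨i, j⟩ n y
      obtain ⟨hx1, hxpow⟩ := exp_pow_bounds hb0 hb1 j.2.le hαb
      have hz : ((g y).1 : ℕ) + N * ((g y).2 : ℕ) ≤ Z := by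
        have := Nat.mul_le_mul_left N (g y).2.2.le
        have := (g y).1.2
        omega
      refine (abs_newton_term_le hb0 hb1 hx1 (hxpow i Z (i.2.le.trans hKZ)) i.2.le hz n).trans ?_
      gcongr
      rw [hB]
      exact le_mul_of_one_le_left (by positivity) (by linarith [(Nat.cast_nonneg Z : (0 : ℝ) ≤ Z)]))
    (by
      rintro ⟨i, j⟩ y
      simp only [hA, Matrix.submatrix_apply, id, Matrix.of_apply]
      generalize g y = rs
      obtain ⟨r, s⟩ := rs
      refine abs_perturbed_sub_newton_le hb0 hb1 i.2.le j.2.le s.2.le ?_ hKZ hαb hΛ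
      have := Nat.mul_le_mul_left N s.2.le
      have := r.2
      change (r : ℕ) + N * (s : ℕ) ≤ Z
      omega)
  rw [hcard] at hlow
  have hbase : D * ((M : ℝ) + 1) * M * B * Real.exp (-((M - 1) / 2)) < 1 := by
    have hMr : (0 : ℝ) < M := by exact_mod_cast hMpos
    have hZr : (0 : ℝ) ≤ Z := Nat.cast_nonneg Z
    have hpos : 0 < D * ((M : ℝ) + 1) * M * B * Real.exp (-((M - 1) / 2)) := by positivity
    rw [← Real.log_neg_iff hpos, Real.log_mul (by positivity) (by positivity), Real.log_exp,
      Real.log_mul (by positivity) (by positivity), Real.log_mul (by positivity) (by positivity),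
      Real.log_mul (by positivity) (by positivity), hD, hB,
      Real.log_mul (by positivity) (by positivity), Real.log_mul (by positivity) (by positivity),
      Real.log_mul (by positivity) (by positivity), Real.log_mul (by positivity) (by positivity),
      Real.log_exp, Real.log_exp, Real.log_inv, Real.log_pow, Real.log_pow, Real.log_pow]
    rw [Real.log_mul (by positivity) (by positivity), Real.log_mul (by positivity) (by positivity),
      one_div, Real.log_inv] at hfin
    have : 0 ≤ b * Z := by positivity
    push_cast at hfin ⊢
    linarith
  have hfact : (M.factorial : ℝ) ≤ (M : ℝ) ^ M := by exact_mod_cast Nat.factorial_le_pow M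
  have : D ^ M * |A.det| < 1 := by
    calc D ^ M * |A.det| ≤ D ^ M * (((M : ℝ) + 1) ^ M * ((M : ℝ) ^ M *
          (B ^ M * Real.exp (-(M * (M - 1) / 2))))) := by
          refine mul_le_mul_of_nonneg_left (hup.trans ?_) (by positivity)
          gcongr
      _ = (D * ((M : ℝ) + 1) * M * B * Real.exp (-((M - 1) / 2))) ^ M := by
          have hexp : Real.exp (-(M * (M - 1) / 2)) = Real.exp (-(((M : ℝ) - 1) / 2)) ^ M := by
            rw [← Real.exp_nat_mul]
            congr 1
            ring
          rw [hexp]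
          simp only [mul_pow]
          ring
      _ < 1 := pow_lt_one₀ (by positivity) hbase hMpos.ne'
  linarith

theorem interpolation_parameters_ineq {Q L n ρ k₁ c₄ : ℕ} {κ lq lv : ℝ} (hκ : 1 ≤ κ)
    (hk₁ : 32 * κ ≤ k₁) (hc₄ : 768 * κ ≤ c₄) (hρ1 : 1 ≤ ρ) (hρ : ρ * c₄ * L ≤ Q)
    (hL1 : 1 ≤ L) (hQL : Q ≤ (L + 1) ^ 4) (hLlog : 64 * Real.log (L + 1) ≤ L) (hLn : L ≤ n)
    (hn : 3 ≤ n) (hlq : lq ≤ κ * Q) (hlv : lv * Q ≤ 3 * (ρ * n) * κ)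
    (hlog : Real.log (10 * ρ * (k₁ * Q * n * L : ℕ) ^ 3) ≤ (k₁ * Q * n * L : ℕ) / 16) :
    L * (n + L : ℕ) * lq + L * (k₁ * Q * L : ℕ) * lv +
      Real.log (((k₁ * Q * n * L : ℕ) + 1) * (k₁ * Q * n * L : ℕ) *
        ((n + L + ρ * n * (k₁ * Q * L) : ℕ) + 2)) +
      8 * (2 * L * κ / Q) * (n + L + ρ * n * (k₁ * Q * L) : ℕ) +
      (k₁ * Q * n : ℕ) * Real.log (1 / (2 * L * κ / Q)) < ((k₁ * Q * n * L : ℕ) - 1) / 2 := by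
  have hκ0 : 0 < κ := by linarith
  have hc₄pos : 0 < c₄ := by
    have : (0 : ℝ) < c₄ := by linarith
    exact_mod_cast this
  have hk₁pos : 0 < k₁ := by
    have : (0 : ℝ) < k₁ := by linarith
    exact_mod_cast this
  have hQpos : 0 < Q := lt_of_lt_of_le (by positivity) hρ
  have hQ1 : (1 : ℝ) ≤ Q := by exact_mod_cast hQpos
  have hL1' : (1 : ℝ) ≤ L := by exact_mod_cast hL1
  have hρ1' : (1 : ℝ) ≤ ρ := by exact_mod_cast hρ1
  have hk₁1' : (1 : ℝ) ≤ k₁ := by exact_mod_cast hk₁pos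
  have hn' : (3 : ℝ) ≤ n := by exact_mod_cast hn
  have hLn' : (L : ℝ) ≤ n := by exact_mod_cast hLn
  have hρ' : (ρ : ℝ) * c₄ * L ≤ Q := by exact_mod_cast hρ
  have hQL' : (Q : ℝ) ≤ (L + 1) ^ 4 := by exact_mod_cast hQL
  push_cast at hlog ⊢
  have hP : (1 : ℝ) ≤ k₁ * Q := by nlinarith
  have hnM : (n : ℝ) ≤ k₁ * Q * n * L := by
    have : (1 : ℝ) * n * 1 ≤ k₁ * Q * n * L := by gcongr
    linarith
  have hML : (L : ℝ) ≤ k₁ * Q * n * L := hLn'.trans hnM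
  obtain ⟨M, hM⟩ : ∃ M : ℝ, M = k₁ * Q * n * L := ⟨_, rfl⟩
  rw [← hM] at hlog hnM hML ⊢
  have hM3 : 3 ≤ M := hn'.trans hnM
  have t1 : L * (n + L) * lq ≤ M / 16 := by
    calc L * (n + L) * lq ≤ L * (n + L) * (κ * Q) := by gcongr
      _ ≤ L * (n + n) * (κ * Q) := by gcongr
      _ = (32 * κ) * (Q * n * L) / 16 := by ring
      _ ≤ k₁ * (Q * n * L) / 16 := by gcongr
      _ = _ := by rw [hM]; ring
  have hρL : (ρ : ℝ) * L * κ * 768 ≤ Q := by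
    calc (ρ : ℝ) * L * κ * 768 = ρ * (768 * κ) * L := by ring
      _ ≤ ρ * c₄ * L := by gcongr
      _ ≤ Q := hρ'
  have t2 : L * (k₁ * Q * L) * lv ≤ M / 16 := by
    calc L * (k₁ * Q * L) * lv = k₁ * L * L * (lv * Q) := by ring
      _ ≤ k₁ * L * L * (3 * (ρ * n) * κ) := by gcongr
      _ = k₁ * n * L * (3 * (ρ * L * κ)) := by ring
      _ ≤ k₁ * n * L * (Q / 16) := by gcongr; linarith [hρL, hQ1]
      _ = _ := by rw [hM]; ring
  obtain ⟨Z, hZ⟩ : ∃ Z : ℝ, Z = n + L + ρ * n * (k₁ * Q * L) := ⟨_, rfl⟩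
  rw [← hZ]
  have hZM : Z ≤ 3 * ρ * M := by
    have e : (ρ : ℝ) * n * (k₁ * Q * L) = ρ * M := by rw [hM]; ring
    rw [hZ, e]
    have : M ≤ ρ * M := le_mul_of_one_le_left (by linarith) hρ1'
    linarith
  have hZ0 : 0 ≤ Z := by rw [hZ]; positivity
  have t3 : Real.log ((M + 1) * M * (Z + 2)) ≤ M / 16 := by
    refine le_trans (Real.log_le_log (by positivity) ?_) hlog
    have h1 : M + 1 ≤ 2 * M := by linarith
    have h2 : Z + 2 ≤ 5 * ρ * M := by
      have : M ≤ ρ * M := le_mul_of_one_le_left (by linarith) hρ1'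
      linarith
    calc (M + 1) * M * (Z + 2) ≤ (2 * M) * M * (5 * ρ * M) := by gcongr
      _ = _ := by ring
  have t4 : 8 * (2 * L * κ / Q) * Z ≤ M / 16 := by
    calc 8 * (2 * L * κ / Q) * Z ≤ 8 * (2 * L * κ / Q) * (3 * ρ * M) := by gcongr
      _ = (ρ * L * κ * 768) / Q * (M / 16) := by ring
      _ ≤ 1 * (M / 16) := by
        gcongr
        rw [div_le_one (by linarith)]
        exact hρL
      _ = _ := one_mul _
  have t5 : k₁ * Q * n * Real.log (1 / (2 * L * κ / Q)) ≤ M / 16 := by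
    have h1 : Real.log (1 / (2 * L * κ / Q)) ≤ L / 16 := by
      have h2 : 1 / (2 * L * κ / Q) ≤ (L + 1 : ℝ) ^ 4 := by
        rw [one_div_div, div_le_iff₀ (by positivity)]
        have : (1 : ℝ) ≤ 2 * L * κ := by nlinarith
        calc (Q : ℝ) ≤ (L + 1) ^ 4 := hQL'
          _ ≤ _ := le_mul_of_one_le_right (by positivity) this
      have h3 := Real.log_le_log (by positivity) h2
      rw [Real.log_pow] at h3
      push_cast at h3
      linarith
    calc k₁ * Q * n * Real.log (1 / (2 * L * κ / Q)) ≤ k₁ * Q * n * (L / 16) := by gcongr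
      _ = _ := by rw [hM]; ring
  linarith

theorem exists_nat_approx {ξ : ℝ} (hξ : Irrational ξ) (hξ0 : 0 < ξ) (C : ℕ) :
    ∃ Q b : ℕ, C ≤ Q ∧ 0 < Q ∧ |Q * ξ - b| ≤ 1 / Q := by
  have key : ∀ C : ℕ, ∃ δ : ℝ, 0 < δ ∧ ∀ a < C, 0 < a →
      δ < |(a : ℝ) * ξ - round ((a : ℝ) * ξ)| := by
    intro C
    induction C with
    | zero => exact ⟨1, one_pos, by simp⟩
    | succ C ih =>
      obtain ⟨δ, hδ, h⟩ := ih
      rcases Nat.eq_zero_or_pos C with hC | hC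
      · exact ⟨1, one_pos, by intro a ha ha'; omega⟩
      · have : 0 < |(C : ℝ) * ξ - round ((C : ℝ) * ξ)| := by
          rw [abs_pos, sub_ne_zero]
          exact (hξ.natCast_mul hC.ne').ne_int _
        refine ⟨min δ (|(C : ℝ) * ξ - round ((C : ℝ) * ξ)| / 2), by positivity, fun a ha ha' => ?_⟩
        rcases Nat.lt_succ_iff_lt_or_eq.mp ha with h' | rfl
        · exact (min_le_left _ _).trans_lt (h a h' ha')
        · exact (min_le_right _ _).trans_lt (by linarith)
  obtain ⟨δ, hδ, h⟩ := key C
  obtain ⟨n, hn⟩ := exists_nat_one_div_lt hδ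
  obtain ⟨a, ha, han, hle⟩ := Real.exists_nat_abs_mul_sub_round_le ξ (Nat.succ_pos n)
  have hround : 0 ≤ round ((a : ℝ) * ξ) := by
    rw [round_eq]
    exact Int.floor_nonneg.mpr (by positivity)
  refine ⟨a, (round ((a : ℝ) * ξ)).toNat, ?_, ha, ?_⟩
  · by_contra! hlt
    have h1 := h a hlt ha
    have h2 : (1 : ℝ) / ((n.succ : ℕ) + 1) ≤ 1 / (n + 1) := by
      push_cast
      gcongr
      linarith
    linarith
  · have e : (((round ((a : ℝ) * ξ)).toNat : ℕ) : ℝ) = (round ((a : ℝ) * ξ) : ℝ) := by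
      have := Int.toNat_of_nonneg hround
      exact_mod_cast this
    rw [e]
    refine hle.trans ?_
    have : (a : ℝ) ≤ n.succ := by exact_mod_cast han
    have ha' : (0 : ℝ) < a := by exact_mod_cast ha
    gcongr
    linarith

theorem irrational_log_div_log {k l : ℕ} (hk : 2 ≤ k) (hl : 2 ≤ l) (hkl : MultIndep k l) :
    Irrational (Real.log k / Real.log l) := by
  have hk' : (1 : ℝ) < k := by exact_mod_cast hk
  have hl' : (1 : ℝ) < l := by exact_mod_cast hl
  have hlk := Real.log_pos hk'
  have hll := Real.log_pos hl'
  rintro ⟨r, hr⟩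
  have hden : (r.den : ℝ) ≠ 0 := by exact_mod_cast r.den_nz
  have h1 : (r.den : ℝ) * Real.log k = r.num * Real.log l := by
    rw [Rat.cast_def] at hr
    field_simp at hr
    linarith
  have h2 : (k : ℝ) ^ (r.den : ℤ) = (l : ℝ) ^ r.num := by
    apply Real.log_injOn_pos (Set.mem_Ioi.mpr (by positivity)) (Set.mem_Ioi.mpr (by positivity))
    rw [Real.log_zpow, Real.log_zpow]
    exact_mod_cast h1
  have h3 := hkl r.den r.num (Rat.cast_injective (α := ℝ) (by push_cast; exact_mod_cast h2))
  exact r.den_nz (by exact_mod_cast h3.1)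

theorem exists_fourth_root (Q L₀ : ℕ) (h : L₀ ^ 4 ≤ Q) :
    ∃ L, L₀ ≤ L ∧ L ^ 4 ≤ Q ∧ Q ≤ (L + 1) ^ 4 := by
  refine ⟨Nat.sqrt (Nat.sqrt Q), ?_, ?_, ?_⟩
  · rw [Nat.le_sqrt', Nat.le_sqrt']
    calc (L₀ ^ 2) ^ 2 = L₀ ^ 4 := by ring
      _ ≤ Q := h
  · calc Nat.sqrt (Nat.sqrt Q) ^ 4 = (Nat.sqrt (Nat.sqrt Q) ^ 2) ^ 2 := by ring
      _ ≤ (Nat.sqrt Q) ^ 2 := by gcongr; exact Nat.sqrt_le' _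
      _ ≤ Q := Nat.sqrt_le' _
  · have h1 := Nat.lt_succ_sqrt' Q
    have h2 := Nat.lt_succ_sqrt' (Nat.sqrt Q)
    calc Q ≤ (Nat.sqrt Q + 1) ^ 2 := h1.le
      _ ≤ ((Nat.sqrt (Nat.sqrt Q) + 1) ^ 2) ^ 2 := by gcongr; exact h2
      _ = _ := by ring

open Filter in
theorem eventually_mul_log_add_one_le (c : ℝ) :
    ∀ᶠ L : ℕ in atTop, c * Real.log (L + 1) ≤ L := by
  have h1 : Tendsto (fun L : ℕ => ((L : ℝ) + 1)) atTop atTop :=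
    tendsto_atTop_add_const_right _ _ tendsto_natCast_atTop_atTop
  have h2 := (Real.isLittleO_log_id_atTop.comp_tendsto h1).def
    (show (0 : ℝ) < 1 / (2 * (|c| + 1)) by positivity)
  filter_upwards [h2, eventually_ge_atTop 1] with L hL hL1
  simp only [Function.comp, id, Real.norm_eq_abs] at hL
  have hL1' : (1 : ℝ) ≤ L := by exact_mod_cast hL1
  rw [abs_of_pos (by positivity : (0 : ℝ) < (L : ℝ) + 1)] at hL
  calc c * Real.log (L + 1) ≤ |c * Real.log (L + 1)| := le_abs_self _
    _ = |c| * |Real.log (L + 1)| := abs_mul _ _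
    _ ≤ (|c| + 1) * (1 / (2 * (|c| + 1)) * (L + 1)) := by gcongr; linarith
    _ = (L + 1) / 2 := by field_simp
    _ ≤ L := by linarith

open Filter in
theorem eventually_log_mul_cube_le {c : ℝ} (hc : 0 < c) :
    ∀ᶠ n : ℕ in atTop, ∀ M : ℕ, n ≤ M → Real.log (c * (M : ℝ) ^ 3) ≤ (M : ℝ) / 16 := by
  have h1 : ∀ᶠ M : ℕ in atTop, Real.log (c * (M : ℝ) ^ 3) ≤ (M : ℝ) / 16 := by
    filter_upwards [eventually_mul_log_add_one_le 96, eventually_ge_atTop 1,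
      tendsto_natCast_atTop_atTop.eventually_ge_atTop (32 * Real.log c)] with M h1 h2 h3
    have hM : (0 : ℝ) < M := by exact_mod_cast h2
    have h4 : Real.log M ≤ Real.log (M + 1) := Real.log_le_log hM (by linarith)
    rw [Real.log_mul hc.ne' (by positivity), Real.log_pow]
    push_cast
    linarith
  exact eventually_forall_ge_atTop.mpr h1

set_option maxHeartbeats 1000000 in
theorem no_small_multiplicative_gap {k l : ℕ} (hk : 2 ≤ k) (hl : 2 ≤ l) (hkl : MultIndep k l)
    {ν : ℝ} (hν : 0 < ν) :
    ∃ μ > 0, ∃ x₀ : ℝ, ∀ x ≥ x₀, ∀ a b A B : ℕ, 1 ≤ A → 1 ≤ B →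
      Real.log A ≤ μ * x → Real.log B ≤ μ * x →
      |a * Real.log k - x| ≤ μ * x → |b * Real.log l - x| ≤ μ * x →
      |a * Real.log k + Real.log A - (b * Real.log l + Real.log B)| ≤ Real.exp (-(ν * x)) →
      False := by
  have hk' : (1 : ℝ) < k := by exact_mod_cast hk
  have hl' : (1 : ℝ) < l := by exact_mod_cast hl
  have hlk : 1 / 2 < Real.log k := by
    have h1 := Real.log_two_gt_d9
    have h2 : Real.log 2 ≤ Real.log k := Real.log_le_log (by norm_num) (by exact_mod_cast hk)
    linarith
  have hll : 1 / 2 < Real.log l := by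
    have h1 := Real.log_two_gt_d9
    have h2 : Real.log 2 ≤ Real.log l := Real.log_le_log (by norm_num) (by exact_mod_cast hl)
    linarith
  have hirr := irrational_log_div_log hk hl hkl
  obtain ⟨lk, hlkdef⟩ : ∃ y, y = Real.log k := ⟨_, rfl⟩
  obtain ⟨ll, hlldef⟩ : ∃ y, y = Real.log l := ⟨_, rfl⟩
  simp only [← hlkdef, ← hlldef] at hlk hll hirr ⊢
  obtain ⟨κ, hκ⟩ : ∃ κ, κ = lk + ll := ⟨_, rfl⟩
  have hκ1 : 1 ≤ κ := by linarith
  obtain ⟨k₁, hk₁⟩ := exists_nat_ge (32 * κ)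
  obtain ⟨c₄, hc₄⟩ := exists_nat_ge (768 * κ)
  have hc₄pos : 0 < c₄ := by
    have : (0 : ℝ) < c₄ := by linarith
    exact_mod_cast this
  have hk₁pos : 0 < k₁ := by
    have : (0 : ℝ) < k₁ := by linarith
    exact_mod_cast this
  obtain ⟨L₀, hL₀⟩ : ∃ L₀ : ℕ, ∀ L ≥ L₀, 64 * Real.log ((L : ℝ) + 1) ≤ L ∧
      8 * (c₄ * k₁) / (ν * lk) ≤ L ∧ 1 ≤ L ∧ c₄ ≤ L := by
    have h1 := eventually_mul_log_add_one_le 64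
    have h2 := tendsto_natCast_atTop_atTop.eventually_ge_atTop (8 * (c₄ * k₁) / (ν * lk))
    exact Filter.eventually_atTop.mp ((h1.and (h2.and ((Filter.eventually_ge_atTop 1).and
      (Filter.eventually_ge_atTop c₄)))))
  obtain ⟨Q, b₀, hQC, hQ0, happ⟩ := exists_nat_approx hirr (by positivity) (L₀ ^ 4)
  obtain ⟨L, hLL, hLQ, hQL⟩ := exists_fourth_root Q L₀ hQC
  obtain ⟨hL1, hL2, hL3, hL4⟩ := hL₀ L hLL
  have hQ' : (1 : ℝ) ≤ Q := by exact_mod_cast hQ0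
  have hL' : (1 : ℝ) ≤ L := by exact_mod_cast hL3
  have hcL : c₄ * L ≤ Q := by
    calc c₄ * L ≤ L * L := by gcongr
      _ = L ^ 2 := by ring
      _ ≤ L ^ 4 := Nat.pow_le_pow_right hL3 (by norm_num)
      _ ≤ Q := hLQ
  obtain ⟨ρ, hρdef⟩ : ∃ ρ, ρ = Q / (c₄ * L) := ⟨_, rfl⟩
  have hρ1 : 1 ≤ ρ := by
    rw [hρdef, Nat.one_le_div_iff (by positivity)]
    exact hcL
  have hρQ : ρ * c₄ * L ≤ Q := by
    rw [mul_assoc, hρdef]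
    exact Nat.div_mul_le_self _ _
  have hQρ : Q ≤ 2 * (ρ * c₄ * L) := by
    have h1 := Nat.lt_div_mul_add (a := Q) (b := c₄ * L) (by positivity)
    rw [← hρdef] at h1
    have h2 : c₄ * L ≤ ρ * (c₄ * L) := Nat.le_mul_of_pos_left _ hρ1
    rw [mul_assoc]
    omega
  have hgap : |Q * lk - b₀ * ll| ≤ ll / Q := by
    have e : Q * lk - b₀ * ll = ll * (Q * (lk / ll) - b₀) := by field_simp
    rw [e, abs_mul, abs_of_pos (by linarith : 0 < ll)]
    calc ll * |Q * (lk / ll) - b₀| ≤ ll * (1 / Q) := by gcongr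
      _ = _ := by ring
  have hne : (Q : ℝ) * lk ≠ b₀ * ll := by
    intro h
    refine hirr ⟨(b₀ : ℚ) / Q, ?_⟩
    push_cast
    field_simp
    linarith
  have hQpos : (0 : ℝ) < Q := by linarith
  have hb₀ : b₀ * ll ≤ κ * Q := by
    have h1 := (abs_le.mp hgap).1
    have h2 : ll / Q ≤ ll * Q :=
      (div_le_self (by linarith) hQ').trans (le_mul_of_one_le_right (by linarith) hQ')
    rw [hκ]
    linarith
  obtain ⟨n₀, hn₀⟩ : ∃ n₀ : ℕ, ∀ n ≥ n₀, (∀ M : ℕ, n ≤ M →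
      Real.log (10 * ρ * (M : ℝ) ^ 3) ≤ (M : ℝ) / 16) ∧ L ≤ n ∧ 3 ≤ n ∧
      Q ^ 2 * lk / ll ≤ n ∧ Real.log (2 * L * (k₁ * Q * L)) ≤ n := by
    have h1 := eventually_log_mul_cube_le (c := 10 * ρ) (by positivity)
    exact Filter.eventually_atTop.mp (h1.and ((Filter.eventually_ge_atTop L).and
      ((Filter.eventually_ge_atTop 3).and
      ((tendsto_natCast_atTop_atTop.eventually_ge_atTop (Q ^ 2 * lk / ll)).and
      (tendsto_natCast_atTop_atTop.eventually_ge_atTop (Real.log (2 * L * (k₁ * Q * L))))))))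
  refine ⟨min (1 / 2) (ll / (12 * lk * Q ^ 2)), by positivity, 2 * lk * (ρ * Q * (n₀ + 1)),
    fun x hx a b A B hA hB hAx hBx hax hbx hsmall => ?_⟩
  have hlk0 : 0 < lk := by linarith
  have hll0 : 0 < ll := by linarith
  have hx0 : 0 < x := lt_of_lt_of_le (by positivity) hx
  have hμ1 : min (1 / 2) (ll / (12 * lk * Q ^ 2)) * x ≤ x / 2 := by
    have := mul_le_mul_of_nonneg_right (min_le_left (1 / 2 : ℝ) (ll / (12 * lk * Q ^ 2))) hx0.le
    linarith
  have hμ2 : min (1 / 2) (ll / (12 * lk * Q ^ 2)) * x ≤ ll / (12 * lk * Q ^ 2) * x :=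
    mul_le_mul_of_nonneg_right (min_le_right _ _) hx0.le
  obtain ⟨y, hy⟩ : ∃ y, y = min (1 / 2) (ll / (12 * lk * Q ^ 2)) * x := ⟨_, rfl⟩
  rw [← hy] at hμ1 hμ2 hAx hBx hax hbx
  rw [abs_le] at hax hbx
  have hρQpos : 0 < ρ * Q := Nat.mul_pos hρ1 hQ0
  obtain ⟨n, hn⟩ : ∃ n, n = a / (ρ * Q) := ⟨_, rfl⟩
  obtain ⟨r, hr⟩ : ∃ r, r = a % (ρ * Q) := ⟨_, rfl⟩
  have hanr : a = ρ * Q * n + r := by rw [hn, hr]; exact (Nat.div_add_mod _ _).symm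
  have hrlt : r < ρ * Q := by rw [hr]; exact Nat.mod_lt _ hρQpos
  have hnn₀ : n₀ ≤ n := by
    rw [hn, Nat.le_div_iff_mul_le hρQpos]
    have h1 : lk * (ρ * Q * (n₀ + 1)) ≤ lk * a := by linarith [hax.1]
    have h2 := le_of_mul_le_mul_left h1 hlk0
    have h3 : ρ * Q * (n₀ + 1) ≤ a := by exact_mod_cast h2
    nlinarith
  obtain ⟨hn1, hn2, hn3, hn4, hn5⟩ := hn₀ n hnn₀
  have hanr' : (a : ℝ) = ρ * Q * n + r := by exact_mod_cast hanr
  have hrlt' : (r : ℝ) ≤ ρ * Q := by exact_mod_cast hrlt.le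
  have hr0 : (0 : ℝ) ≤ r := Nat.cast_nonneg r
  have hn3' : (3 : ℝ) ≤ n := by exact_mod_cast hn3
  have hρ1' : (1 : ℝ) ≤ ρ := by exact_mod_cast hρ1
  have hk₁1 : (1 : ℝ) ≤ k₁ := by exact_mod_cast hk₁pos
  have hc₄1 : (1 : ℝ) ≤ c₄ := by exact_mod_cast hc₄pos
  obtain ⟨sp, sm, hs, hsm⟩ : ∃ sp sm : ℕ, (sp : ℝ) - sm = b - (ρ * n : ℕ) * b₀ ∧
      (sm = 0 ∨ (sm : ℝ) = (ρ * n : ℕ) * b₀ - b) := by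
    rcases le_total b (ρ * n * b₀) with h | h
    · obtain ⟨c, hc⟩ := Nat.exists_eq_add_of_le h
      have hc' : ((ρ * n : ℕ) : ℝ) * b₀ = b + c := by exact_mod_cast hc
      refine ⟨0, c, ?_, Or.inr ?_⟩
      · rw [hc']; push_cast; ring
      · rw [hc']; ring
    · obtain ⟨c, hc⟩ := Nat.exists_eq_add_of_le h
      have hc' : (b : ℝ) = ((ρ * n : ℕ) : ℝ) * b₀ + c := by exact_mod_cast hc
      refine ⟨c, 0, ?_, Or.inl rfl⟩
      rw [hc']; push_cast; ring
  have hA0 : (0 : ℝ) < A := by exact_mod_cast hA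
  have hB0 : (0 : ℝ) < B := by exact_mod_cast hB
  have hk0 : (0 : ℝ) < k := by linarith
  have hl0 : (0 : ℝ) < l := by linarith
  have hlogp : Real.log ((k ^ Q : ℕ) : ℝ) = Q * lk := by
    rw [Nat.cast_pow, Real.log_pow, hlkdef]
  have hlogq : Real.log ((l ^ b₀ : ℕ) : ℝ) = b₀ * ll := by
    rw [Nat.cast_pow, Real.log_pow, hlldef]
  have hlogu : Real.log ((l ^ sp * B : ℕ) : ℝ) = sp * ll + Real.log B := by
    push_cast
    rw [Real.log_mul (by positivity) (by positivity), Real.log_pow, hlldef]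
  have hlogv : Real.log ((k ^ r * A * l ^ sm : ℕ) : ℝ) = r * lk + Real.log A + sm * ll := by
    push_cast
    rw [Real.log_mul (by positivity) (by positivity), Real.log_mul (by positivity) (by positivity),
      Real.log_pow, Real.log_pow, hlldef, hlkdef]
  have hxn : x ≤ 4 * lk * Q * (ρ * n) := by
    have h1 : (ρ : ℝ) * Q ≤ ρ * Q * n := le_mul_of_one_le_right (by positivity) (by linarith)
    have h2 : lk * a ≤ lk * (2 * (ρ * Q * n)) := by gcongr; linarith
    linarith [hax.1]
  have hyn : 3 * y ≤ ρ * n * ll / Q := by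
    calc 3 * y ≤ 3 * (ll / (12 * lk * Q ^ 2) * (4 * lk * Q * (ρ * n))) := by
          have : ll / (12 * lk * Q ^ 2) * x ≤ ll / (12 * lk * Q ^ 2) * (4 * lk * Q * (ρ * n)) := by
            gcongr
          linarith
      _ = _ := by field_simp; norm_num
  have hy0 : 0 ≤ y := by linarith [hax.1, hax.2]
  have hgap' := abs_le.mp hgap
  have hsmle : sm * ll ≤ 2 * y + ρ * n * ll / Q := by
    rcases hsm with h | h
    · rw [h, Nat.cast_zero, zero_mul]
      positivity
    · have h1 : (ρ : ℝ) * n * (b₀ * ll - Q * lk) ≤ ρ * n * (ll / Q) := by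
        gcongr
        linarith
      rw [h]
      push_cast
      have h2 : (a : ℝ) * lk = ρ * Q * n * lk + r * lk := by rw [hanr']; ring
      have h3 : 0 ≤ r * lk := by positivity
      have h4 : (ρ : ℝ) * n * (ll / Q) = ρ * n * ll / Q := by ring
      linarith [hax.2, hbx.1]
  have hrl : r * lk ≤ ρ * n * ll / Q := by
    calc r * lk ≤ ρ * Q * lk := by gcongr
      _ = ρ * (Q ^ 2 * lk / ll) * ll / Q := by field_simp
      _ ≤ ρ * n * ll / Q := by gcongr
  have hlv : Real.log ((k ^ r * A * l ^ sm : ℕ) : ℝ) * Q ≤ 3 * (ρ * n) * κ := by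
    have h1 : Real.log ((k ^ r * A * l ^ sm : ℕ) : ℝ) ≤ 3 * (ρ * n * ll / Q) := by
      rw [hlogv]
      linarith
    calc _ ≤ 3 * (ρ * n * ll / Q) * Q := by gcongr
      _ = 3 * (ρ * n) * ll := by field_simp
      _ ≤ _ := by gcongr; linarith
  have hb1 : 2 * L * κ / Q ≤ 1 := by
    rw [div_le_one hQpos]
    have h1 : (c₄ : ℝ) * L ≤ Q := by exact_mod_cast hcL
    nlinarith
  have hΛ : 2 * L * (k₁ * Q * L : ℕ) * Real.exp (-(ν * x)) ≤
      Real.exp (-((k₁ * Q * n * L : ℕ) : ℝ)) := by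
    have hpos : (0 : ℝ) < 2 * L * (k₁ * Q * L) := by positivity
    have hMn : (n : ℝ) ≤ k₁ * Q * n * L := by
      have : (1 : ℝ) * 1 * n * 1 ≤ k₁ * Q * n * L := by gcongr
      linarith
    have hxlow : (ρ : ℝ) * Q * n * lk ≤ 2 * x := by
      have h2 : (a : ℝ) * lk = ρ * Q * n * lk + r * lk := by rw [hanr']; ring
      have h3 : 0 ≤ r * lk := by positivity
      linarith [hax.2]
    have hνL : 8 * (c₄ * k₁) ≤ ν * lk * L := by
      rw [div_le_iff₀ (by positivity)] at hL2
      linarith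
    have hQρ' : (Q : ℝ) ≤ 2 * (ρ * c₄ * L) := by exact_mod_cast hQρ
    have hLQ' : (L : ℝ) ^ 4 ≤ Q := by exact_mod_cast hLQ
    have hmain : 2 * (k₁ * Q * n * L) ≤ ν * x := by
      have h1 : 8 * (c₄ * k₁) * (L : ℝ) ^ 2 ≤ ν * lk * Q := by
        calc 8 * (c₄ * k₁) * (L : ℝ) ^ 2 ≤ ν * lk * L * (L : ℝ) ^ 2 := by gcongr
          _ = ν * lk * (L ^ 3 * 1) := by ring
          _ ≤ ν * lk * (L ^ 3 * L) := by gcongr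
          _ = ν * lk * L ^ 4 := by ring
          _ ≤ _ := by gcongr
      have h2 : 8 * (c₄ * k₁) * (L : ℝ) ^ 2 * (Q * n) ≤ ν * (2 * x) * (2 * c₄ * L) := by
        calc 8 * (c₄ * k₁) * (L : ℝ) ^ 2 * (Q * n) ≤ ν * lk * Q * (Q * n) := by gcongr
          _ ≤ ν * lk * (2 * (ρ * c₄ * L)) * (Q * n) := by gcongr
          _ = ν * (ρ * Q * n * lk) * (2 * c₄ * L) := by ring
          _ ≤ _ := by gcongr
      have h3 : (4 * c₄ * L : ℝ) * (2 * (k₁ * Q * n * L)) ≤ (4 * c₄ * L) * (ν * x) := by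
        linarith
      exact le_of_mul_le_mul_left h3 (by positivity)
    push_cast
    rw [← Real.exp_log hpos, ← Real.exp_add, Real.exp_le_exp]
    linarith
  refine no_small_linear_form (p := k ^ Q) (q := l ^ b₀) (u := l ^ sp * B)
    (v := k ^ r * A * l ^ sm) (N := ρ * n) (K := k₁ * Q * n) (L := L) (R := n) (S := k₁ * Q * L)
    (b := 2 * L * κ / Q) (by positivity) (by positivity) (by positivity) (by positivity) ?_
    (by positivity) (by positivity) (Nat.le_mul_of_pos_left _ hρ1) (le_of_eq (by ring))
    (by positivity) hb1 ?_ ?_ ?_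
  · intro h
    apply hne
    rw [← hlogp, ← hlogq, h]
  · rw [hlogp, hlogq]
    calc L * |Q * lk - b₀ * ll| ≤ L * (ll / Q) := by gcongr
      _ ≤ L * (κ / Q) := by gcongr; linarith
      _ = _ := by ring
  · rw [hlogp, hlogq, hlogu, hlogv]
    refine le_trans ?_ hΛ
    gcongr
    refine le_trans (le_of_eq ?_) hsmall
    congr 1
    rw [hanr']
    push_cast at hs ⊢
    linear_combination (-ll) * hs
  · rw [hlogq]
    exact interpolation_parameters_ineq hκ1 hk₁ hc₄ hρ1 hρQ hL3 hQL hL1 hn2 hn3 hb₀ hlv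
      (hn1 _ (by
        calc n = 1 * 1 * n * 1 := by ring
          _ ≤ k₁ * Q * n * L := by gcongr <;> omega))

theorem decodeTuple_append (k d : ℕ) (u v : List (Fin d → Fin k)) (i : Fin d) :
    decodeTuple k d (u ++ v) i = decodeTuple k d u i * k ^ v.length + decodeTuple k d v i := by
  induction v using List.reverseRecOn with
  | nil => simp [decodeTuple]
  | append_singleton v c ih =>
    have h : ∀ w : List (Fin d → Fin k),
        decodeTuple k d (w ++ [c]) i = k * decodeTuple k d w i + (c i : ℕ) := by
      intro w
      simp [decodeTuple]
    rw [← List.append_assoc, h, h, ih, List.length_append, List.length_singleton, pow_succ]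
    ring

theorem decodeTuple_lt {k : ℕ} (d : ℕ) (w : List (Fin d → Fin k)) (i : Fin d) :
    decodeTuple k d w i < k ^ w.length := by
  induction w with
  | nil => simp [decodeTuple]
  | cons c w ih =>
    have h := decodeTuple_append k d [c] w i
    have hc : decodeTuple k d [c] i = c i := by simp [decodeTuple]
    rw [List.singleton_append, hc] at h
    have h2 : ((c i : ℕ) + 1) * k ^ w.length ≤ k * k ^ w.length :=
      Nat.mul_le_mul_right _ (c i).2
    rw [h, List.length_cons, pow_succ, mul_comm _ k]
    linarith

theorem exists_canonicalWord {k : ℕ} (hk : 2 ≤ k) (d : ℕ) (f : Fin d → ℕ) :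
    ∃ w : List (Fin d → Fin k), CanonicalWord w ∧ decodeTuple k d w = f := by
  obtain ⟨N, hN⟩ : ∃ N, ∀ i, f i ≤ N := ⟨∑ i, f i, fun i =>
    Finset.single_le_sum (fun _ _ => Nat.zero_le _) (Finset.mem_univ i)⟩
  induction N generalizing f with
  | zero =>
    refine ⟨[], by simp [CanonicalWord], ?_⟩
    funext i
    have := hN i
    simp only [decodeTuple, List.foldl_nil]
    omega
  | succ N ih =>
    have hdiv : ∀ i, f i / k ≤ N := by
      intro i
      have h1 := hN i
      have h2 : f i / k ≤ f i / 2 := Nat.div_le_div_left hk (by norm_num)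
      omega
    obtain ⟨w, hw, hdec⟩ := ih (fun i => f i / k) hdiv
    by_cases hf : f = 0
    · exact ⟨[], by simp [CanonicalWord], by rw [hf]; rfl⟩
    refine ⟨w ++ [fun i => ⟨f i % k, Nat.mod_lt _ (by omega)⟩], ?_, ?_⟩
    · cases w with
      | nil =>
        intro c hc
        simp only [List.nil_append, List.head?_cons, Option.mem_some_iff] at hc
        subst hc
        by_contra! hall
        refine hf (funext fun i => ?_)
        have h1 := congrFun hdec i
        simp only [decodeTuple, List.foldl_nil] at h1
        have h2 := hall i
        have := Nat.div_add_mod (f i) k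
        simp only at h2
        rw [← h1, h2] at this
        simpa using this.symm
      | cons c w => simpa [CanonicalWord] using hw
    · funext i
      rw [decodeTuple_append, hdec]
      simp only [decodeTuple, List.length_singleton, pow_one, List.foldl_cons, List.foldl_nil,
        mul_zero, zero_add]
      rw [mul_comm]
      exact Nat.div_add_mod _ _

open Filter in
theorem exists_mul_pow_lt_two_pow (C c h e N : ℕ) :
    ∃ n, N ≤ n ∧ C * (c + n * h) ^ e < 2 ^ n := by
  have h1 : Tendsto (fun n : ℕ => (n : ℝ) ^ e / 2 ^ n) atTop (nhds 0) :=
    tendsto_pow_const_div_const_pow_of_one_lt e (by norm_num)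
  have h2 : ∀ᶠ n : ℕ in atTop, (n : ℝ) ^ e / 2 ^ n < 1 / ((C : ℝ) * (c + h) ^ e + 1) :=
    h1.eventually_lt_const (by positivity)
  obtain ⟨n, hn1, hn2, hn3⟩ := (h2.and ((eventually_ge_atTop N).and (eventually_ge_atTop 1))).exists
  refine ⟨n, hn2, ?_⟩
  rw [div_lt_div_iff₀ (by positivity) (by positivity), one_mul] at hn1
  have h3 : c + n * h ≤ n * (c + h) := by nlinarith
  have h4 : (C * (c + n * h) ^ e : ℝ) < 2 ^ n := by
    calc (C * (c + n * h) ^ e : ℝ) ≤ C * (n * (c + h)) ^ e := by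
          gcongr
          exact_mod_cast h3
      _ = n ^ e * (C * (c + h) ^ e) := by rw [mul_pow]; ring
      _ ≤ n ^ e * (C * (c + h) ^ e + 1) := by gcongr; linarith
      _ < 2 ^ n := hn1
  exact_mod_cast h4

/-- Two words of equal length which can be freely pumped inside a sparse language coincide. -/
theorem IsSparseLang.eq_of_pump {α : Type*} [Finite α] {L : Language α} (hL : IsSparseLang L)
    {u v y z : List α} (hlen : y.length = z.length)
    (hmem : ∀ l : List (List α), (∀ t ∈ l, t = y ∨ t = z) → u ++ l.flatten ++ v ∈ L) : y = z := by
  by_contra hne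
  obtain ⟨e, C, N, hcount⟩ := hL
  have hy : 0 < y.length := by
    rcases Nat.eq_zero_or_pos y.length with h | h
    · exact absurd ((List.length_eq_zero_iff.mp h).trans
        (List.length_eq_zero_iff.mp (hlen ▸ h)).symm) hne
    · exact h
  obtain ⟨n, hn, hlt⟩ := exists_mul_pow_lt_two_pow C (u.length + v.length) y.length e N
  let g : (Fin n → Bool) → List (List α) := fun b => List.ofFn fun i => if b i then y else z
  have hgmem : ∀ b, ∀ t ∈ g b, t = y ∨ t = z := by
    intro b t ht
    obtain ⟨i, rfl⟩ := (List.mem_ofFn' _ _).mp ht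
    by_cases h : b i <;> simp [h]
  have hglen : ∀ b, ∀ t ∈ g b, t.length = y.length := by
    intro b t ht
    rcases hgmem b t ht with rfl | rfl
    · rfl
    · exact hlen.symm
  have hinj : Function.Injective fun b => u ++ (g b).flatten ++ v := by
    intro b b' h
    have h1 : (g b).flatten = (g b').flatten :=
      List.append_cancel_left (List.append_cancel_right h)
    have h2 : g b = g b' := by
      refine List.eq_iff_flatten_eq.mpr ⟨h1, ?_⟩
      rw [List.map_congr_left (hglen b), List.map_congr_left (hglen b'), List.map_const',
        List.map_const', List.length_ofFn, List.length_ofFn]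
    have h3 := List.ofFn_injective h2
    funext i
    have h4 := congrFun h3 i
    by_cases hb : b i <;> by_cases hb' : b' i <;> simp_all
  have hflen : ∀ b, (u ++ (g b).flatten ++ v).length = u.length + v.length + n * y.length := by
    intro b
    have : (g b).flatten.length = n * y.length := by
      rw [List.length_flatten, List.map_congr_left (hglen b), List.map_const', List.sum_replicate,
        List.length_ofFn, smul_eq_mul]
    rw [List.length_append, List.length_append, this]
    ring
  set m := u.length + v.length + n * y.length with hm
  have hsub : Set.range (fun b => u ++ (g b).flatten ++ v) ⊆ {w ∈ L | w.length ≤ m} := by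
    rintro _ ⟨b, rfl⟩
    exact ⟨hmem _ (hgmem b), (hflen b).le⟩
  have hfin : {w ∈ L | w.length ≤ m}.Finite :=
    (List.finite_length_le α m).subset fun w hw => hw.2
  have h5 := Set.ncard_le_ncard hsub hfin
  rw [Set.ncard_range_of_injective hinj, Nat.card_eq_fintype_card, Fintype.card_fun,
    Fintype.card_bool, Fintype.card_fin] at h5
  have h6 := hcount m (by nlinarith)
  omega

theorem DFA.evalFrom_flatten_of_loops {α σ : Type*} (M : DFA α σ) (q : σ) (l : List (List α))
    (h : ∀ t ∈ l, M.evalFrom q t = q) : M.evalFrom q l.flatten = q := by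
  induction l with
  | nil => simp
  | cons t l ih =>
    rw [List.flatten_cons, DFA.evalFrom_of_append, h t (by simp)]
    exact ih fun t ht => h t (by simp [ht])

theorem mul_decodeTuple_eq_of_append_comm {k d : ℕ} {x y : List (Fin d → Fin k)}
    (h : x ++ y = y ++ x) (i : Fin d) :
    decodeTuple k d x i * k ^ y.length + decodeTuple k d y i =
      decodeTuple k d y i * k ^ x.length + decodeTuple k d x i := by
  rw [← decodeTuple_append, ← decodeTuple_append, h]

/-- `n` has only boundedly many positions in its base `k` expansion around which it is not
close to a rational multiple, with bounded denominator, of a power of `k`. -/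
def HasGaps (k : ℕ) (S : Set ℕ) : Prop :=
  ∃ m C : ℕ, ∀ n ∈ S, ∃ F : Finset ℕ, F.card ≤ m ∧ ∀ s' s : ℕ, s' ≤ s → k ^ s ≤ n →
    (∀ x ∈ F, ¬ (s' ≤ x ∧ x ≤ s)) →
    ∃ D A : ℕ, 0 < D ∧ D ≤ C ∧ 0 < A ∧ |(D : ℤ) * n - k ^ s * A| ≤ D * k ^ s'

theorem gap_of_loop {k d : ℕ} (hk : 2 ≤ k) {u x y v : List (Fin d → Fin k)} {i : Fin d}
    (hx : x ≠ []) (hxy : x ++ y = y ++ x) {n s s' : ℕ} (hn : decodeTuple k d (u ++ y ++ v) i = n)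
    (hs : y.length + v.length = s) (hs' : v.length ≤ s') (hkn : k ^ s ≤ n) :
    ∃ A : ℕ, 0 < A ∧ |((k ^ x.length - 1 : ℕ) : ℤ) * n - k ^ s * A| ≤
      (k ^ x.length - 1 : ℕ) * k ^ s' := by
  have hcomm := mul_decodeTuple_eq_of_append_comm hxy i
  have hyv := decodeTuple_lt d (y ++ v) i
  have hv := decodeTuple_lt d v i
  have hx' := decodeTuple_lt d x i
  have hxlen : 0 < x.length := List.length_pos_iff.mpr hx
  rw [List.append_assoc, decodeTuple_append, decodeTuple_append, List.length_append, hs] at hn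
  rw [decodeTuple_append, List.length_append, hs] at hyv
  generalize decodeTuple k d u i = U at *
  generalize decodeTuple k d x i = c at *
  generalize decodeTuple k d y i = Y at *
  generalize decodeTuple k d v i = V at *
  have hU : 0 < U := by
    rcases Nat.eq_zero_or_pos U with h | h
    · rw [h, zero_mul, zero_add] at hn
      omega
    · exact h
  have hkx : 2 ≤ k ^ x.length := hk.trans (Nat.le_self_pow hxlen.ne' k)
  obtain ⟨D, hD⟩ : ∃ D, k ^ x.length = D + 1 := ⟨k ^ x.length - 1, by omega⟩
  rw [hD] at hcomm hx' hkx ⊢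
  rw [Nat.add_sub_cancel]
  have hDpos : 0 < D := by omega
  refine ⟨D * U + c, by positivity, ?_⟩
  have hpow : k ^ s = k ^ y.length * k ^ v.length := by rw [← hs, pow_add]
  have hpow' : k ^ v.length ≤ k ^ s' := Nat.pow_le_pow_right (by omega) hs'
  have e : (D : ℤ) * n - k ^ s * (D * U + c : ℕ) = D * V - c * k ^ v.length := by
    have h1 : (n : ℤ) = U * (k ^ y.length * k ^ v.length) + (Y * k ^ v.length + V) := by
      rw [← hn, hpow]; push_cast; ring
    have h2 : (c : ℤ) * k ^ y.length + Y = Y * (D + 1) + c := by exact_mod_cast hcomm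
    have h3 : (k : ℤ) ^ s = k ^ y.length * k ^ v.length := by exact_mod_cast hpow
    rw [h1, h3]
    push_cast
    linear_combination (-(k : ℤ) ^ v.length) * h2
  rw [e]
  have hcD : c ≤ D := by omega
  have b1 : D * V ≤ D * k ^ s' := Nat.mul_le_mul_left _ (hv.le.trans hpow')
  have b2 : c * k ^ v.length ≤ D * k ^ s' := Nat.mul_le_mul hcD hpow'
  have b1' : (D : ℤ) * V ≤ D * k ^ s' := by exact_mod_cast b1
  have b2' : (c : ℤ) * k ^ v.length ≤ D * k ^ s' := by exact_mod_cast b2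
  have b3 : (0 : ℤ) ≤ D * V := by positivity
  have b4 : (0 : ℤ) ≤ c * k ^ v.length := by positivity
  rw [abs_le]
  constructor <;> linarith

theorem exists_loop_of_no_visits {α σ : Type*} [Fintype σ] (M : DFA α σ) (w : List α) :
    ∃ F : Finset ℕ, F.card ≤ 2 * Fintype.card σ ∧ ∀ s' s : ℕ, s' ≤ s → s ≤ w.length →
      (∀ x ∈ F, ¬ (s' ≤ x ∧ x ≤ s)) →
      ∃ u y v : List α, w = u ++ y ++ v ∧ y ≠ [] ∧ y.length + v.length = s ∧
        v.length ≤ s' ∧ M.evalFrom (M.eval u) y = M.eval u := by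
  classical
  set T := w.length with hT
  let V : σ → Finset ℕ := fun q => (Finset.range (T + 1)).filter fun t => M.eval (w.take t) = q
  refine ⟨Finset.univ.biUnion fun q => {T - sInf (V q : Set ℕ), T - (V q).sup id}, ?_, ?_⟩
  · refine Finset.card_biUnion_le.trans ?_
    refine (Finset.sum_le_card_nsmul _ _ 2 fun q _ => Finset.card_le_two).trans ?_
    rw [Finset.card_univ, smul_eq_mul, mul_comm]
  · intro s' s hss hs hF
    obtain ⟨q, hq⟩ : ∃ q, q = M.eval (w.take (T - s)) := ⟨_, rfl⟩
    have hmem : T - s ∈ V q := by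
      simp only [V, Finset.mem_filter, Finset.mem_range]
      exact ⟨by omega, hq.symm⟩
    have hne : (V q).Nonempty := ⟨_, hmem⟩
    have h1 := hF (T - sInf (V q : Set ℕ)) (Finset.mem_biUnion.mpr ⟨q, by simp, by simp⟩)
    have h2 := hF (T - (V q).sup id) (Finset.mem_biUnion.mpr ⟨q, by simp, by simp⟩)
    have h3 : sInf (V q : Set ℕ) ≤ T - s := Nat.sInf_le hmem
    obtain ⟨g, hg, hgsup⟩ := Finset.exists_mem_eq_sup (V q) hne id
    have h4 : T - s ≤ (V q).sup id := Finset.le_sup (f := id) hmem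
    rw [hgsup] at h2 h4
    simp only [id] at h2 h4
    simp only [V, Finset.mem_filter, Finset.mem_range] at hg
    obtain ⟨hgT, hgq⟩ := hg
    have htake : w.take (T - s) ++ (w.drop (T - s)).take (g - (T - s)) = w.take g := by
      rw [← List.take_add, Nat.add_sub_cancel' h4]
    refine ⟨w.take (T - s), (w.drop (T - s)).take (g - (T - s)), w.drop g, ?_, ?_, ?_, ?_, ?_⟩
    · rw [htake, List.take_append_drop]
    · intro h
      have := congrArg List.length h
      rw [List.length_take, List.length_drop, List.length_nil] at this
      omega
    · rw [List.length_take, List.length_drop, List.length_drop]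
      omega
    · rw [List.length_drop]
      omega
    · rw [← hq]
      conv_rhs => rw [← hgq]
      rw [hq, ← htake]
      simp only [DFA.eval, DFA.evalFrom_of_append]

theorem IsSparseAutomatic.hasGaps {k d : ℕ} (hk : 2 ≤ k) {S : Set (Fin d → ℕ)}
    (hS : IsSparseAutomatic k d S) (i : Fin d) : HasGaps k ((fun f => f i) '' S) := by
  classical
  obtain ⟨⟨σ, _, M, hM⟩, hsparse⟩ := hS
  let x : σ → List (Fin d → Fin k) := fun q =>
    if h : ∃ x, x ≠ [] ∧ M.evalFrom q x = q then h.choose else []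
  have hx : ∀ q y, y ≠ [] → M.evalFrom q y = q → x q ≠ [] ∧ M.evalFrom q (x q) = q := by
    intro q y hy hyq
    have h : ∃ x, x ≠ [] ∧ M.evalFrom q x = q := ⟨y, hy, hyq⟩
    simp only [x, dif_pos h]
    exact h.choose_spec
  refine ⟨2 * Fintype.card σ, Finset.univ.sup fun q => k ^ (x q).length - 1, ?_⟩
  rintro n ⟨f, hf, rfl⟩
  obtain ⟨w, hw, hdec⟩ := exists_canonicalWord hk d f
  obtain ⟨F, hFcard, hF⟩ := exists_loop_of_no_visits M w
  refine ⟨F, hFcard, fun s' s hss hks hwin => ?_⟩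
  have hsT : s ≤ w.length := by
    have h1 := decodeTuple_lt d w i
    rw [hdec] at h1
    exact ((Nat.pow_lt_pow_iff_right (by omega)).mp (hks.trans_lt h1)).le
  obtain ⟨u, y, v, rfl, hy, hlen, hv, hloop⟩ := hF s' s hss hsT hwin
  obtain ⟨hx1, hx2⟩ := hx _ y hy hloop
  set q := M.eval u with hq
  have hcomm : x q ++ y = y ++ x q := by
    refine hsparse.eq_of_pump (u := u) (v := y ++ v) (by simp [add_comm]) fun l hl => ?_
    have hdfa : ∀ l : List (List (Fin d → Fin k)), (∀ t ∈ l, M.evalFrom q t = q) →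
        M.eval (u ++ l.flatten ++ (y ++ v)) = M.eval (u ++ y ++ v) := by
      intro l hl
      simp only [DFA.eval, DFA.evalFrom_of_append]
      rw [← DFA.eval, ← hq, M.evalFrom_flatten_of_loops q l hl]
    have hacc : u ++ y ++ v ∈ M.accepts := by
      rw [hM]
      exact ⟨hw, hdec ▸ hf⟩
    rw [← hM]
    rw [DFA.mem_accepts] at hacc ⊢
    rw [hdfa]
    · exact hacc
    · intro t ht
      rcases hl t ht with rfl | rfl
      · rw [DFA.evalFrom_of_append, hx2, hloop]
      · rw [DFA.evalFrom_of_append, hloop, hx2]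
  obtain ⟨A, hA, hle⟩ := gap_of_loop hk hx1 hcomm (congrFun hdec i) hlen hv hks
  have hxlen : 0 < (x q).length := List.length_pos_iff.mpr hx1
  have hkx : 2 ≤ k ^ (x q).length := hk.trans (Nat.le_self_pow hxlen.ne' k)
  exact ⟨_, A, by omega, Finset.le_sup (f := fun q => k ^ (x q).length - 1) (Finset.mem_univ q),
    hA, hle⟩

theorem abs_log_le_two_mul {z δ : ℝ} (hδ : δ ≤ 1 / 2) (hz : |z - 1| ≤ δ) :
    |Real.log z| ≤ 2 * δ := by
  have h := abs_le.mp hz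
  have hz0 : 0 < z := by linarith
  have h1 := Real.log_le_sub_one_of_pos hz0
  have h2 := Real.one_sub_inv_le_log_of_pos hz0
  have h3 : z⁻¹ ≤ 1 + 2 * δ := by
    rw [inv_le_iff_one_le_mul₀ hz0]
    nlinarith
  rw [abs_le]
  constructor <;> linarith

theorem abs_log_approx {k n s s' D A : ℕ} {ν : ℝ} (hk : 2 ≤ k) (hn : 0 < n) (hD : 0 < D)
    (hA : 0 < A) (hle : |(D : ℤ) * n - k ^ s * A| ≤ D * k ^ s')
    (hs' : s' * Real.log k ≤ (1 - ν) * Real.log n + Real.log k)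
    (hsmall : 2 * k * Real.exp (-(ν * Real.log n)) ≤ 1) :
    |s * Real.log k + Real.log A - Real.log D - Real.log n| ≤
      2 * k * Real.exp (-(ν * Real.log n)) := by
  have hk0 : (0 : ℝ) < k := by exact_mod_cast (by omega : 0 < k)
  have hn0 : (0 : ℝ) < n := by exact_mod_cast hn
  have hD0 : (0 : ℝ) < D := by exact_mod_cast hD
  have hA0 : (0 : ℝ) < A := by exact_mod_cast hA
  have hle' : |(D : ℝ) * n - k ^ s * A| ≤ D * k ^ s' := by exact_mod_cast hle
  have hpow : (k : ℝ) ^ s' ≤ n * (k * Real.exp (-(ν * Real.log n))) := by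
    rw [← Real.exp_log (pow_pos hk0 s'), Real.log_pow]
    conv_rhs => rw [← Real.exp_log hn0, ← Real.exp_log hk0, Real.log_exp, ← Real.exp_add,
      ← Real.exp_add]
    rw [Real.exp_le_exp]
    linarith
  have hz : |(k : ℝ) ^ s * A / (D * n) - 1| ≤ k * Real.exp (-(ν * Real.log n)) := by
    have e : (k : ℝ) ^ s * A / (D * n) - 1 = -((D * n - k ^ s * A) / (D * n)) := by
      field_simp
      ring
    rw [e, abs_neg, abs_div, abs_of_pos (by positivity : (0 : ℝ) < D * n),
      div_le_iff₀ (by positivity)]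
    calc |(D : ℝ) * n - k ^ s * A| ≤ D * k ^ s' := hle'
      _ ≤ D * (n * (k * Real.exp (-(ν * Real.log n)))) := by gcongr
      _ = _ := by ring
  have h := abs_log_le_two_mul (by linarith) hz
  rw [Real.log_div (by positivity) (by positivity), Real.log_mul (by positivity) (by positivity),
    Real.log_mul (by positivity) (by positivity), Real.log_pow, ← sub_sub, ← mul_assoc] at h
  exact h

theorem exists_approx_of_window {k n C : ℕ} {F : Finset ℕ} {ν ν' : ℝ} (hk : 2 ≤ k) (hn : 0 < n)
    (hν1 : ν ≤ 1) (hν'0 : 0 ≤ ν') (hνν' : ν' ≤ ν)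
    (hgap : ∀ s' s : ℕ, s' ≤ s → k ^ s ≤ n → (∀ x ∈ F, ¬ (s' ≤ x ∧ x ≤ s)) →
      ∃ D A : ℕ, 0 < D ∧ D ≤ C ∧ 0 < A ∧ |(D : ℤ) * n - k ^ s * A| ≤ D * k ^ s')
    (hwin : ∀ x ∈ F, ¬ ((1 - ν) * Real.log n ≤ x * Real.log k ∧
      x * Real.log k ≤ (1 - ν') * Real.log n))
    (hlong : 2 * Real.log k ≤ (ν - ν') * Real.log n)
    (hsmall : 2 * k * Real.exp (-(ν * Real.log n)) ≤ 1) :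
    ∃ s D A : ℕ, 0 < D ∧ D ≤ C ∧ 0 < A ∧ (1 - ν') * Real.log n - Real.log k ≤ s * Real.log k ∧
      s * Real.log k ≤ (1 - ν') * Real.log n ∧
      |s * Real.log k + Real.log A - Real.log D - Real.log n| ≤
        2 * k * Real.exp (-(ν * Real.log n)) := by
  have hlk : 0 < Real.log k := Real.log_pos (by exact_mod_cast hk)
  have hlogn : 0 ≤ Real.log n := Real.log_natCast_nonneg n
  have hk0 : (0 : ℝ) < k := by exact_mod_cast (by omega : 0 < k)
  have hn0 : (0 : ℝ) < n := by exact_mod_cast hn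
  have ha : 0 ≤ (1 - ν) * Real.log n / Real.log k :=
    div_nonneg (mul_nonneg (by linarith) hlogn) hlk.le
  have hb : 0 ≤ (1 - ν') * Real.log n / Real.log k :=
    div_nonneg (mul_nonneg (by linarith) hlogn) hlk.le
  obtain ⟨s, hs⟩ : ∃ s, s = ⌊(1 - ν') * Real.log n / Real.log k⌋₊ := ⟨_, rfl⟩
  obtain ⟨s', hs'⟩ : ∃ s', s' = ⌈(1 - ν) * Real.log n / Real.log k⌉₊ := ⟨_, rfl⟩
  have h1 : s * Real.log k ≤ (1 - ν') * Real.log n := by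
    rw [← le_div_iff₀ hlk, hs]
    exact Nat.floor_le hb
  have h2 : (1 - ν') * Real.log n < (s + 1) * Real.log k := by
    rw [← div_lt_iff₀ hlk, hs]
    exact Nat.lt_floor_add_one _
  have h3 : (1 - ν) * Real.log n ≤ s' * Real.log k := by
    rw [← div_le_iff₀ hlk, hs']
    exact Nat.le_ceil _
  have h4 : s' * Real.log k < (1 - ν) * Real.log n + Real.log k := by
    have h5 := Nat.ceil_lt_add_one ha
    rw [← hs', ← sub_lt_iff_lt_add, lt_div_iff₀ hlk] at h5
    linarith
  have hss : s' ≤ s := by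
    have h5 : s' * Real.log k ≤ s * Real.log k := by linarith
    exact_mod_cast le_of_mul_le_mul_right h5 hlk
  have hks : k ^ s ≤ n := by
    have h5 : (k : ℝ) ^ s ≤ n := by
      rw [← Real.log_le_log_iff (by positivity) hn0, Real.log_pow]
      have : 0 ≤ ν' * Real.log n := mul_nonneg hν'0 hlogn
      linarith
    exact_mod_cast h5
  obtain ⟨D, A, hD, hDC, hA, hle⟩ := hgap s' s hss hks fun x hx hx' => by
    refine hwin x hx ⟨h3.trans ?_, le_trans ?_ h1⟩
    · gcongr
      exact hx'.1
    · gcongr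
      exact hx'.2
  exact ⟨s, D, A, hD, hDC, hA, by linarith, h1, abs_log_approx hk hn hD hA hle h4.le hsmall⟩

open Filter in
theorem exists_inner_exponent {k l : ℕ} (hk : 2 ≤ k) (hl : 2 ≤ l) (hkl : MultIndep k l) (C C' : ℕ)
    {ν : ℝ} (hν : 0 < ν) :
    ∃ ν', 0 < ν' ∧ ν' < ν ∧ ∀ᶠ x : ℝ in atTop,
      2 * Real.log k ≤ (ν - ν') * x ∧ 2 * Real.log l ≤ (ν - ν') * x ∧
      2 * k * Real.exp (-(ν * x)) ≤ 1 ∧ 2 * l * Real.exp (-(ν * x)) ≤ 1 ∧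
      ∀ s D A t E B : ℕ, 0 < D → D ≤ C → 0 < A → 0 < E → E ≤ C' → 0 < B →
        (1 - ν') * x - Real.log k ≤ s * Real.log k → s * Real.log k ≤ (1 - ν') * x →
        (1 - ν') * x - Real.log l ≤ t * Real.log l → t * Real.log l ≤ (1 - ν') * x →
        |s * Real.log k + Real.log A - Real.log D - x| ≤ 2 * k * Real.exp (-(ν * x)) →
        |t * Real.log l + Real.log B - Real.log E - x| ≤ 2 * l * Real.exp (-(ν * x)) → False := by
  have hlk : 0 < Real.log k := Real.log_pos (by exact_mod_cast hk)
  have hll : 0 < Real.log l := Real.log_pos (by exact_mod_cast hl)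
  have hk0 : (0 : ℝ) < k := by exact_mod_cast (by omega : 0 < k)
  have hl0 : (0 : ℝ) < l := by exact_mod_cast (by omega : 0 < l)
  obtain ⟨μ, hμ, x₀, hkey⟩ := no_small_multiplicative_gap hk hl hkl (half_pos hν)
  obtain ⟨ν', hν'⟩ : ∃ ν', ν' = min (μ / 2) (ν / 2) := ⟨_, rfl⟩
  have hν'0 : 0 < ν' := by rw [hν']; positivity
  have hν'μ : ν' ≤ μ / 2 := hν' ▸ min_le_left _ _
  have hν'ν : ν' ≤ ν / 2 := hν' ▸ min_le_right _ _
  refine ⟨ν', hν'0, by linarith, ?_⟩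
  have hlin : ∀ a c : ℝ, 0 < a → ∀ᶠ x : ℝ in atTop, c ≤ a * x := fun a c ha =>
    (tendsto_id.const_mul_atTop ha).eventually_ge_atTop c
  filter_upwards [eventually_ge_atTop x₀, eventually_ge_atTop 0, hlin (ν / 2) (2 * Real.log k)
    (by positivity), hlin (ν / 2) (2 * Real.log l) (by positivity),
    hlin (ν / 2) (Real.log (2 * k + 2 * l)) (by positivity),
    hlin ν' (Real.log C + Real.log C' + 1 + Real.log k + Real.log l) hν'0]
    with x hx₀ hx0 h1 h2 h3 h4
  have hνx : (ν / 2) * x ≤ (ν - ν') * x := by gcongr; linarith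
  have hexp : (2 * k + 2 * l) * Real.exp (-(ν * x)) ≤ Real.exp (-(ν / 2 * x)) := by
    rw [← Real.exp_log (by positivity : (0 : ℝ) < 2 * k + 2 * l), ← Real.exp_add, Real.exp_le_exp]
    linarith
  have hexp1 : Real.exp (-(ν / 2 * x)) ≤ 1 := Real.exp_le_one_iff.mpr (by
    have : 0 ≤ ν / 2 * x := by positivity
    linarith)
  have hek : 0 ≤ 2 * k * Real.exp (-(ν * x)) := by positivity
  have hel : 0 ≤ 2 * l * Real.exp (-(ν * x)) := by positivity
  have hk1 : 2 * k * Real.exp (-(ν * x)) ≤ 1 := by linarith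
  have hl1 : 2 * l * Real.exp (-(ν * x)) ≤ 1 := by linarith
  refine ⟨h1.trans hνx, h2.trans hνx, hk1, hl1, ?_⟩
  intro s D A t E B hD hDC hA hE hEC hB hs1 hs2 ht1 ht2 hsA htB
  have hD0 : (0 : ℝ) < D := by exact_mod_cast hD
  have hE0 : (0 : ℝ) < E := by exact_mod_cast hE
  have hA0 : (0 : ℝ) < A := by exact_mod_cast hA
  have hB0 : (0 : ℝ) < B := by exact_mod_cast hB
  have hlD : Real.log D ≤ Real.log C := Real.log_le_log hD0 (by exact_mod_cast hDC)
  have hlE : Real.log E ≤ Real.log C' := Real.log_le_log hE0 (by exact_mod_cast hEC)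
  have hlC : 0 ≤ Real.log C := Real.log_natCast_nonneg C
  have hlC' : 0 ≤ Real.log C' := Real.log_natCast_nonneg C'
  have hν'x : 0 ≤ ν' * x := by positivity
  have hμx : 2 * (ν' * x) ≤ μ * x := by
    have : ν' * x ≤ μ / 2 * x := by gcongr
    linarith
  have hsA' := abs_le.mp hsA
  have htB' := abs_le.mp htB
  refine hkey x hx₀ s t (A * E) (B * D) (Nat.mul_pos hA hE) (Nat.mul_pos hB hD) ?_ ?_ ?_ ?_ ?_
  · push_cast
    rw [Real.log_mul hA0.ne' hE0.ne']
    linarith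
  · push_cast
    rw [Real.log_mul hB0.ne' hD0.ne']
    linarith
  · rw [abs_le]
    constructor <;> linarith
  · rw [abs_le]
    constructor <;> linarith
  · push_cast
    rw [Real.log_mul hA0.ne' hE0.ne', Real.log_mul hB0.ne' hD0.ne', abs_le]
    constructor <;> linarith

theorem exists_interval_disjoint {a b : ℕ → ℝ} (hab : ∀ i, b i < a (i + 1)) (ha : Monotone a)
    (P : Finset ℝ) : ∃ i ≤ P.card, ∀ p ∈ P, ¬ (a i ≤ p ∧ p ≤ b i) := by
  by_contra! h
  choose! f hf using h
  obtain ⟨i, hi, j, hj, hne, heq⟩ := Finset.exists_ne_map_eq_of_card_lt_of_maps_to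
    (s := Finset.range (P.card + 1)) (t := P) (by simp) (f := f)
    (fun i hi => (hf i (Nat.lt_succ_iff.mp (Finset.mem_range.mp hi))).1)
  have hi' := hf i (Nat.lt_succ_iff.mp (Finset.mem_range.mp hi))
  have hj' := hf j (Nat.lt_succ_iff.mp (Finset.mem_range.mp hj))
  rcases lt_or_gt_of_ne hne with h | h
  · have h1 := ha (Nat.succ_le_of_lt h)
    have h2 := hab i
    simp only [Nat.succ_eq_add_one] at h1
    linarith [hi'.2.2, hj'.2.1]
  · have h1 := ha (Nat.succ_le_of_lt h)
    have h2 := hab j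
    simp only [Nat.succ_eq_add_one] at h1
    linarith [hj'.2.2, hi'.2.1]

open Filter in
theorem HasGaps.inter_finite {k l : ℕ} (hk : 2 ≤ k) (hl : 2 ≤ l) (hkl : MultIndep k l)
    {S S' : Set ℕ} (hS : HasGaps k S) (hS' : HasGaps l S') : (S ∩ S').Finite := by
  classical
  obtain ⟨m, C, hS⟩ := hS
  obtain ⟨m', C', hS'⟩ := hS'
  choose! f hf0 hflt hf using fun ν (hν : 0 < ν) => exists_inner_exponent hk hl hkl C C' hν
  let e : ℕ → ℝ := fun i => (fun ν => f ν / 2)^[i] 1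
  have he_succ : ∀ i, e (i + 1) = f (e i) / 2 := fun i => Function.iterate_succ_apply' _ _ _
  have he0 : ∀ i, 0 < e i := by
    intro i
    induction i with
    | zero => exact one_pos
    | succ i ih => rw [he_succ]; exact half_pos (hf0 _ ih)
  have he_lt : ∀ i, e (i + 1) < f (e i) := fun i => by
    rw [he_succ]
    exact half_lt_self (hf0 _ (he0 i))
  have he_anti : Antitone e := antitone_nat_of_succ_le fun i =>
    ((he_lt i).trans (hflt _ (he0 i))).le
  have hev : ∀ᶠ x : ℝ in atTop, ∀ i ∈ Finset.range (m + m' + 1), _ :=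
    (Finset.eventually_all _).mpr fun i _ => hf (e i) (he0 i)
  have hev' : ∀ᶠ n : ℕ in atTop, n ∉ S ∩ S' := by
    filter_upwards [(Real.tendsto_log_atTop.comp tendsto_natCast_atTop_atTop).eventually hev,
      eventually_ge_atTop 2] with n hn hn2
    rintro ⟨hnS, hnS'⟩
    obtain ⟨F, hFcard, hF⟩ := hS n hnS
    obtain ⟨F', hF'card, hF'⟩ := hS' n hnS'
    have hlogn : 0 < Real.log n := Real.log_pos (by exact_mod_cast hn2)
    obtain ⟨i, hi, hwin⟩ := exists_interval_disjoint (a := fun i => 1 - e i)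
      (b := fun i => 1 - f (e i)) (fun i => by linarith [he_lt i])
      (fun i j hij => sub_le_sub_left (he_anti hij) 1)
      (F.image (fun x : ℕ => x * Real.log k / Real.log n) ∪
        F'.image (fun x : ℕ => x * Real.log l / Real.log n))
    have hi' : i ∈ Finset.range (m + m' + 1) := by
      rw [Finset.mem_range, Nat.lt_succ_iff]
      exact hi.trans ((Finset.card_union_le _ _).trans (add_le_add
        (Finset.card_image_le.trans hFcard) (Finset.card_image_le.trans hF'card)))
    obtain ⟨g1, g2, g3, g4, g5⟩ := hn i hi'
    have he1 : e i ≤ 1 := he_anti (Nat.zero_le i)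
    obtain ⟨s, D, A, hD, hDC, hA, hs1, hs2, hsA⟩ := exists_approx_of_window hk (by omega) he1
      (hf0 _ (he0 i)).le (hflt _ (he0 i)).le hF (fun x hx hx' => hwin _
        (Finset.mem_union_left _ (Finset.mem_image_of_mem _ hx))
        ⟨(le_div_iff₀ hlogn).mpr hx'.1, (div_le_iff₀ hlogn).mpr hx'.2⟩) g1 g3
    obtain ⟨t, E, B, hE, hEC, hB, ht1, ht2, htB⟩ := exists_approx_of_window hl (by omega) he1
      (hf0 _ (he0 i)).le (hflt _ (he0 i)).le hF' (fun x hx hx' => hwin _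
        (Finset.mem_union_right _ (Finset.mem_image_of_mem _ hx))
        ⟨(le_div_iff₀ hlogn).mpr hx'.1, (div_le_iff₀ hlogn).mpr hx'.2⟩) g2 g4
    exact g5 s D A t E B hD hDC hA hE hEC hB hs1 hs2 ht1 ht2 hsA htB
  obtain ⟨N, hN⟩ := eventually_atTop.mp hev'
  refine (Set.finite_lt_nat N).subset fun n hn => ?_
  by_contra hlt
  exact hN n (not_lt.mp hlt) hn

/-- If `k` and `ℓ` are multiplicatively independent integers, each at least 2,
`d ≥ 1`, `X ⊆ ℕ^d` is a sparse `k`-automatic set and `Y ⊆ ℕ^d` is a sparse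
`ℓ`-automatic set, then `X ∩ Y` is finite. -/
theorem sparse_automatic_intersection_finite
    (k l d : ℕ) (hk : 2 ≤ k) (hl : 2 ≤ l) (hd : 1 ≤ d)
    (hkl : MultIndep k l)
    (X Y : Set (Fin d → ℕ))
    (hX : IsSparseAutomatic k d X) (hY : IsSparseAutomatic l d Y) :
    (X ∩ Y).Finite := by
  refine (Set.Finite.pi fun i => (hX.hasGaps hk i).inter_finite hk hl hkl
    (hY.hasGaps hl i)).subset fun f hf => ?_
  exact fun i _ => ⟨⟨f, hf.1, rfl⟩, ⟨f, hf.2, rfl⟩⟩
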